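/- arXiv:1502.03656 — 3 statements merged into one kernel-verified Lean document; each statement's English description precedes it below -/
import Mathlib

section
/- Let α ∈ (0,2] with α ≠ 1 and β ∈ [−1,1], and set T(α,β) = (1/α)·arctan(β·tan(πα/2)). Let W be distributed according to the exponential distribution with rate 1 on (0,∞) and let U be distributed uniformly on (−π/2, π/2), independently. Then the random variable Ȳ = sin(α(U + T(α,β))) / (cos(α·T(α,β))·cos U)^{1/α} · ( cos(α·T(α,β) + (α−1)·U) / W )^{(1−α)/α} has characteristic function t ↦ exp(−|t|^α · (1 − i·β·tan(πα/2)·sgn t)). Equivalently, the pushforward of the product measure Exp(1) ⊗ Uniform(−π/2,π/2) under the map (w,u) ↦ sin(α(u+T))/ (cos(αT)·cos u)^{1/α} · (cos(αT+(α−1)u)/w)^{(1−α)/α} has this characteristic function. -/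
open MeasureTheory Real Complex

/-- The characteristic function of a measure `P` on `ℝ`. -/
noncomputable def charFunc (P : Measure ℝ) (t : ℝ) : ℂ :=
  ∫ x, Complex.exp (Complex.I * t * x) ∂P

/-- The exponential distribution with rate 1 on `(0,∞)`. -/
noncomputable def expOne : Measure ℝ :=
  (volume.restrict (Set.Ioi (0 : ℝ))).withDensity fun w => ENNReal.ofReal (Real.exp (-w))

/-- The uniform distribution on `(-π/2, π/2)`. -/
noncomputable def unifHalfPi : Measure ℝ :=
  (ENNReal.ofReal (π⁻¹)) • volume.restrict (Set.Ioo (-(π / 2)) (π / 2))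

namespace CMS

noncomputable def wf (α γ u : ℝ) : ℝ := Real.cos ((α - 1) * u + γ) / Real.cos u
noncomputable def cf (α γ u : ℝ) : ℝ := Real.sin (α * u + γ) / Real.cos u
noncomputable def FF (α γ a u s : ℝ) : ℂ :=
  Complex.exp (-((a * Real.exp (α * s) * wf α γ u : ℝ) : ℂ)
    - I * ((a * Real.exp ((α - 1) * s) * cf α γ u : ℝ) : ℂ))
noncomputable def DD (u s : ℝ) : ℂ := (Real.sinh s : ℂ) + I * (Real.sin u : ℂ)
noncomputable def MM (u s : ℝ) : ℂ := (Real.cos u : ℂ) / DD u s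
noncomputable def NN (u s : ℝ) : ℂ := ((Real.exp s : ℂ) + I * (Real.sin u : ℂ)) / DD u s

noncomputable def wf' (α γ u : ℝ) : ℝ :=
  (-((α - 1) * Real.sin ((α - 1) * u + γ)) * Real.cos u
    + Real.cos ((α - 1) * u + γ) * Real.sin u) / Real.cos u ^ 2
noncomputable def cf' (α γ u : ℝ) : ℝ :=
  (α * Real.cos (α * u + γ) * Real.cos u + Real.sin (α * u + γ) * Real.sin u) / Real.cos u ^ 2

lemma hasDerivAt_wf (α γ u : ℝ) (hu : Real.cos u ≠ 0) :
    HasDerivAt (wf α γ) (wf' α γ u) u := by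
  have h1 : HasDerivAt (fun u : ℝ => (α - 1) * u + γ) (α - 1) u := by
    simpa using ((hasDerivAt_id u).const_mul (α - 1)).add_const γ
  refine (h1.cos.div (Real.hasDerivAt_cos u) hu).congr_deriv ?_
  simp only [wf']; ring

lemma hasDerivAt_cf (α γ u : ℝ) (hu : Real.cos u ≠ 0) :
    HasDerivAt (cf α γ) (cf' α γ u) u := by
  have h1 : HasDerivAt (fun u : ℝ => α * u + γ) α u := by
    simpa using ((hasDerivAt_id u).const_mul α).add_const γ
  refine (h1.sin.div (Real.hasDerivAt_cos u) hu).congr_deriv ?_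
  simp only [cf']; ring

lemma hasDerivAt_FF_u (α γ a u s : ℝ) (hu : Real.cos u ≠ 0) :
    HasDerivAt (fun u => FF α γ a u s)
      (FF α γ a u s * (-((a * Real.exp (α * s) * wf' α γ u : ℝ) : ℂ)
        - I * ((a * Real.exp ((α - 1) * s) * cf' α γ u : ℝ) : ℂ))) u := by
  have h1 := ((hasDerivAt_wf α γ u hu).const_mul (a * Real.exp (α * s))).ofReal_comp
  have h2 := (((hasDerivAt_cf α γ u hu).const_mul
    (a * Real.exp ((α - 1) * s))).ofReal_comp).const_mul I
  exact (h1.neg.sub h2).cexp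

lemma hasDerivAt_FF_s (α γ a u s : ℝ) :
    HasDerivAt (fun s => FF α γ a u s)
      (FF α γ a u s * (-((α * (a * Real.exp (α * s) * wf α γ u) : ℝ) : ℂ)
        - I * (((α - 1) * (a * Real.exp ((α - 1) * s) * cf α γ u) : ℝ) : ℂ))) s := by
  have h0 (k : ℝ) (c : ℝ) : HasDerivAt (fun s : ℝ => a * Real.exp (k * s) * c)
      (k * (a * Real.exp (k * s) * c)) s := by
    have : HasDerivAt (fun s : ℝ => k * s) k s := by
      simpa using ((hasDerivAt_id s).const_mul k)
    refine ((this.exp.const_mul a).mul_const c).congr_deriv ?_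
    ring
  have h1 := (h0 α (wf α γ u)).ofReal_comp
  have h2 := ((h0 (α - 1) (cf α γ u)).ofReal_comp).const_mul I
  exact (h1.neg.sub h2).cexp

lemma hasDerivAt_MM_u (u s : ℝ) (hD : DD u s ≠ 0) :
    HasDerivAt (fun u => MM u s)
      ((-(Real.sin u : ℂ) * DD u s - (Real.cos u : ℂ) * (I * (Real.cos u : ℂ))) / DD u s ^ 2) u := by
  have h1 := (Real.hasDerivAt_cos u).ofReal_comp
  have h2 := (((Real.hasDerivAt_sin u).ofReal_comp).const_mul I).const_add (Real.sinh s : ℂ)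
  refine (h1.div h2 hD).congr_deriv ?_
  simp [DD]

lemma hasDerivAt_NN_s (u s : ℝ) (hD : DD u s ≠ 0) :
    HasDerivAt (fun s => NN u s)
      (((Real.exp s : ℂ) * DD u s - ((Real.exp s : ℂ) + I * (Real.sin u : ℂ)) * (Real.cosh s : ℂ))
        / DD u s ^ 2) s := by
  have h1 := ((Real.hasDerivAt_exp s).ofReal_comp).add_const (I * (Real.sin u : ℂ))
  have h2 := ((Real.hasDerivAt_sinh s).ofReal_comp).add_const (I * (Real.sin u : ℂ))
  exact (h1.div h2 hD)

/-- The key divergence identity. -/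
lemma key_identity (α γ a u s : ℝ) (F F0 : ℂ) (hu : Real.cos u ≠ 0) (hD : DD u s ≠ 0) :
    I * (F * (-((a * Real.exp (α * s) * wf' α γ u : ℝ) : ℂ)
        - I * ((a * Real.exp ((α - 1) * s) * cf' α γ u : ℝ) : ℂ)) * MM u s
      + (F - F0) * ((-(Real.sin u : ℂ) * DD u s - (Real.cos u : ℂ) * (I * (Real.cos u : ℂ))) / DD u s ^ 2))
    + (F * (-((α * (a * Real.exp (α * s) * wf α γ u) : ℝ) : ℂ)
        - I * (((α - 1) * (a * Real.exp ((α - 1) * s) * cf α γ u) : ℝ) : ℂ)) * NN u s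
      + (F - F0) * (((Real.exp s : ℂ) * DD u s - ((Real.exp s : ℂ) + I * (Real.sin u : ℂ)) * (Real.cosh s : ℂ))
        / DD u s ^ 2))
    = -2 * ((α * (a * Real.exp (α * s) * wf α γ u) : ℝ) : ℂ) * F := by
  have e1 : Real.exp s = Real.cosh s + Real.sinh s := by rw [Real.cosh_add_sinh]
  have hcs : Real.cosh s ^ 2 - Real.sinh s ^ 2 = 1 := Real.cosh_sq_sub_sinh_sq s
  have hsc : Real.sin u ^ 2 + Real.cos u ^ 2 = 1 := Real.sin_sq_add_cos_sq u
  have p1 : I * ((-(Real.sin u : ℂ) * DD u s - (Real.cos u : ℂ) * (I * (Real.cos u : ℂ))) / DD u s ^ 2)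
     + (((Real.exp s : ℂ) * DD u s - ((Real.exp s : ℂ) + I * (Real.sin u : ℂ)) * (Real.cosh s : ℂ))
        / DD u s ^ 2) = 0 := by
    rw [← mul_div_assoc, ← add_div, div_eq_zero_iff]
    left
    rw [e1]
    have hcs' : (Real.cosh s : ℂ) ^ 2 - (Real.sinh s : ℂ) ^ 2 = 1 := by exact_mod_cast hcs
    have hsc' : (Real.sin u : ℂ) ^ 2 + (Real.cos u : ℂ) ^ 2 = 1 := by exact_mod_cast hsc
    push_cast [DD] at *
    linear_combination (- (Complex.sin u)^2 - (Complex.cos u)^2) * Complex.I_sq + hsc' - hcs'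
  set E := a * Real.exp ((α - 1) * s) with hE
  have eE : a * Real.exp (α * s) = E * Real.exp s := by
    rw [hE, mul_assoc, ← Real.exp_add]; ring_nf
  have hr1 : α * wf α γ u = (α - 1) * cf α γ u * Real.sin u + cf' α γ u * Real.cos u := by
    have : (α - 1) * u + γ = (α * u + γ) - u := by ring
    simp only [wf, cf, cf', this, Real.cos_sub]
    field_simp
    ring
  have hr2 : (α - 1) * cf α γ u + wf' α γ u * Real.cos u = α * wf α γ u * Real.sin u := by
    have : (α - 1) * u + γ = (α * u + γ) - u := by ring
    simp only [wf, cf, wf', this, Real.cos_sub, Real.sin_sub]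
    field_simp
    linear_combination -(α - 1) * Real.sin (α * u + γ) * hsc
  have p2 : I * ((-((a * Real.exp (α * s) * wf' α γ u : ℝ) : ℂ)
        - I * ((E * cf' α γ u : ℝ) : ℂ)) * MM u s)
     + (-((α * (a * Real.exp (α * s) * wf α γ u) : ℝ) : ℂ)
        - I * (((α - 1) * (E * cf α γ u) : ℝ) : ℂ)) * NN u s
     = -2 * ((α * (a * Real.exp (α * s) * wf α γ u) : ℝ) : ℂ) := by
    rw [eE, MM, NN]
    have hinv : Real.exp s * (Real.cosh s - Real.sinh s) = 1 := by
      rw [e1]; linear_combination hcs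
    have h2s : 2 * Real.sinh s = Real.exp s - (Real.cosh s - Real.sinh s) := by rw [e1]; ring
    have c1 := congrArg (Complex.ofReal) hr1
    have c2 := congrArg (Complex.ofReal) hr2
    have c3 := congrArg (Complex.ofReal) hinv
    have c4 := congrArg (Complex.ofReal) h2s
    rw [← mul_div_assoc, ← mul_div_assoc, ← mul_div_assoc, ← add_div, div_eq_iff hD]
    rw [show DD u s = (Real.sinh s : ℂ) + I * (Real.sin u : ℂ) from rfl]
    clear_value E
    push_cast at *
    linear_combination -I * E * Complex.exp s * c2 - E * c1 - α * E * wf α γ u * c3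
      + α * E * wf α γ u * Complex.exp s * c4
      + (-(E * cf' α γ u * Complex.cos u) - (α - 1) * E * cf α γ u * Complex.sin u) * Complex.I_sq
  linear_combination (F - F0) * p1 + F * p2
end CMS

namespace CMS

lemma DD_re (u s : ℝ) : (DD u s).re = Real.sinh s := by
  simp [DD, -Complex.ofReal_sinh, -Complex.ofReal_sin]
lemma DD_im (u s : ℝ) : (DD u s).im = Real.sin u := by
  simp [DD, -Complex.ofReal_sinh, -Complex.ofReal_sin]
lemma sinh_le_DD (u s : ℝ) : |Real.sinh s| ≤ ‖DD u s‖ := by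
  rw [← DD_re u s]; exact Complex.abs_re_le_norm _
lemma sin_le_DD (u s : ℝ) : |Real.sin u| ≤ ‖DD u s‖ := by
  rw [← DD_im u s]; exact Complex.abs_im_le_norm _
lemma cosh_le_DD (u s : ℝ) : |Real.sin u| * Real.cosh s ≤ ‖DD u s‖ := by
  have h := Complex.sq_norm (DD u s)
  rw [Complex.normSq_apply, DD_re, DD_im] at h
  apply le_of_sq_le_sq _ (norm_nonneg _)
  rw [h, mul_pow, sq_abs, Real.cosh_sq]
  nlinarith [Real.sin_sq_le_one u, sq_nonneg (Real.sinh s)]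
lemma DD_ne {u s : ℝ} (hu : Real.sin u ≠ 0) : DD u s ≠ 0 := by
  intro h
  have := sin_le_DD u s
  rw [h] at this
  simp at this
  exact hu this
lemma DD_ne' {u s : ℝ} (hs : s ≠ 0) : DD u s ≠ 0 := by
  intro h
  have := sinh_le_DD u s
  rw [h] at this
  simp at this
  exact hs this

lemma norm_FF (α γ a u s : ℝ) :
    ‖FF α γ a u s‖ = Real.exp (-(a * Real.exp (α * s) * wf α γ u)) := by
  rw [FF, Complex.norm_exp]
  congr 1
  simp only [Complex.sub_re, Complex.neg_re, Complex.ofReal_re, Complex.mul_re, Complex.I_re,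
    Complex.I_im, Complex.ofReal_im]
  ring

lemma norm_FF_le (α γ a u s : ℝ) (ha : 0 ≤ a) (hw : 0 ≤ wf α γ u) : ‖FF α γ a u s‖ ≤ 1 := by
  rw [norm_FF, Real.exp_le_one_iff]
  have := mul_nonneg (mul_nonneg ha (Real.exp_pos (α * s)).le) hw
  linarith

lemma diff_FF (α γ a : ℝ) (p : ℝ × ℝ) (hu : Real.cos p.1 ≠ 0) :
    DifferentiableAt ℝ (fun p : ℝ × ℝ => FF α γ a p.1 p.2) p := by
  unfold FF wf cf
  have h1 : DifferentiableAt ℝ (fun p : ℝ × ℝ => a * Real.exp (α * p.2) *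
      (Real.cos ((α - 1) * p.1 + γ) / Real.cos p.1)) p := by
    fun_prop (disch := assumption)
  have h2 : DifferentiableAt ℝ (fun p : ℝ × ℝ => a * Real.exp ((α - 1) * p.2) *
      (Real.sin (α * p.1 + γ) / Real.cos p.1)) p := by
    fun_prop (disch := assumption)
  have h1' := Complex.ofRealCLM.differentiableAt.comp p h1
  have h2' := Complex.ofRealCLM.differentiableAt.comp p h2
  exact (h1'.neg.sub (h2'.const_mul I)).cexp

lemma diff_DD (p : ℝ × ℝ) :
    DifferentiableAt ℝ (fun p : ℝ × ℝ => DD p.1 p.2) p := by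
  unfold DD
  have h1 : DifferentiableAt ℝ (fun p : ℝ × ℝ => Real.sinh p.2) p := by fun_prop
  have h2 : DifferentiableAt ℝ (fun p : ℝ × ℝ => Real.sin p.1) p := by fun_prop
  have h1' := Complex.ofRealCLM.differentiableAt.comp p h1
  have h2' := Complex.ofRealCLM.differentiableAt.comp p h2
  exact (h1'.add (h2'.const_mul I))

lemma diff_MM (p : ℝ × ℝ) (hD : DD p.1 p.2 ≠ 0) :
    DifferentiableAt ℝ (fun p : ℝ × ℝ => MM p.1 p.2) p := by
  simp only [MM, div_eq_mul_inv]
  have h2 : DifferentiableAt ℝ (fun p : ℝ × ℝ => Real.cos p.1) p := by fun_prop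
  have h2' := Complex.ofRealCLM.differentiableAt.comp p h2
  have h := h2'.mul (DifferentiableAt.inv (h := fun p : ℝ × ℝ => DD p.1 p.2) (diff_DD p) hD)
  exact h

lemma diff_NN (p : ℝ × ℝ) (hD : DD p.1 p.2 ≠ 0) :
    DifferentiableAt ℝ (fun p : ℝ × ℝ => NN p.1 p.2) p := by
  simp only [NN, div_eq_mul_inv]
  have h1 : DifferentiableAt ℝ (fun p : ℝ × ℝ => Real.exp p.2) p := by fun_prop
  have h2 : DifferentiableAt ℝ (fun p : ℝ × ℝ => Real.sin p.1) p := by fun_prop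
  have h1' := Complex.ofRealCLM.differentiableAt.comp p h1
  have h2' := Complex.ofRealCLM.differentiableAt.comp p h2
  have h := (h1'.add (h2'.const_mul I)).mul (DifferentiableAt.inv (h := fun p : ℝ × ℝ => DD p.1 p.2) (diff_DD p) hD)
  exact h

/-- derivative of `W` in the log-radius variable -/
noncomputable def WS (α γ a u s : ℝ) : ℝ := α * (a * Real.exp (α * s) * wf α γ u)

lemma divergence (α γ a : ℝ) (F0 : ℂ) (u₁ u₂ S : ℝ)
    (hc : ∀ u ∈ Set.uIcc u₁ u₂, Real.cos u ≠ 0) (hs : ∀ u ∈ Set.uIcc u₁ u₂, Real.sin u ≠ 0) :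
    (∫ u in u₁..u₂, ∫ s in (-S)..S, -2 * (WS α γ a u s : ℂ) * FF α γ a u s) =
      (((∫ u in u₁..u₂, (FF α γ a u S - F0) * NN u S)
        - ∫ u in u₁..u₂, (FF α γ a u (-S) - F0) * NN u (-S))
        + ∫ s in (-S)..S, I * ((FF α γ a u₂ s - F0) * MM u₂ s))
        - ∫ s in (-S)..S, I * ((FF α γ a u₁ s - F0) * MM u₁ s) := by
  set f : ℝ × ℝ → ℂ := fun p => I * ((FF α γ a p.1 p.2 - F0) * MM p.1 p.2) with hf
  set g : ℝ × ℝ → ℂ := fun p => (FF α γ a p.1 p.2 - F0) * NN p.1 p.2 with hg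
  have dF : ∀ p ∈ Set.uIcc u₁ u₂ ×ˢ Set.uIcc (-S) S, DifferentiableAt ℝ f p := fun p hp =>
    (((diff_FF α γ a p (hc _ hp.1)).sub_const F0).mul (diff_MM p (DD_ne (hs _ hp.1)))).const_mul I
  have dG : ∀ p ∈ Set.uIcc u₁ u₂ ×ˢ Set.uIcc (-S) S, DifferentiableAt ℝ g p := fun p hp =>
    (((diff_FF α γ a p (hc _ hp.1)).sub_const F0).mul (diff_NN p (DD_ne (hs _ hp.1))))
  have hsub : ∀ p, p ∈ (Set.Ioo (min u₁ u₂) (max u₁ u₂) ×ˢ Set.Ioo (min (-S) S) (max (-S) S)) \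
      (∅ : Set (ℝ × ℝ)) → p ∈ Set.uIcc u₁ u₂ ×ˢ Set.uIcc (-S) S := fun p hp =>
    ⟨Set.Ioo_subset_Icc_self hp.1.1, Set.Ioo_subset_Icc_self hp.1.2⟩
  have hdiv : ∀ p ∈ Set.uIcc u₁ u₂ ×ˢ Set.uIcc (-S) S,
      fderiv ℝ f p (1, 0) + fderiv ℝ g p (0, 1) =
        -2 * (WS α γ a p.1 p.2 : ℂ) * FF α γ a p.1 p.2 := by
    rintro ⟨u, s⟩ hp
    have hcu := hc _ hp.1
    have hD : DD u s ≠ 0 := DD_ne (hs _ hp.1)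
    have e1 : HasDerivAt (fun x : ℝ => f (x, s)) (fderiv ℝ f (u, s) (1, 0)) u :=
      HasFDerivAt.comp_hasDerivAt (f := fun x : ℝ => (x, s)) u (dF _ hp).hasFDerivAt
        ((hasDerivAt_id u).prodMk (hasDerivAt_const u s))
    have e2 : HasDerivAt (fun x : ℝ => g (u, x)) (fderiv ℝ g (u, s) (0, 1)) s :=
      HasFDerivAt.comp_hasDerivAt (f := fun x : ℝ => (u, x)) s (dG _ hp).hasFDerivAt
        ((hasDerivAt_const s u).prodMk (hasDerivAt_id s))
    have e1' := (((hasDerivAt_FF_u α γ a u s hcu).sub_const F0).mul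
      (hasDerivAt_MM_u u s hD)).const_mul I
    have e2' := (((hasDerivAt_FF_s α γ a u s).sub_const F0).mul (hasDerivAt_NN_s u s hD))
    rw [e1.unique e1', e2.unique e2']
    exact key_identity α γ a u s _ F0 hcu hD
  have hcont : ContinuousOn (fun p : ℝ × ℝ => -2 * (WS α γ a p.1 p.2 : ℂ) * FF α γ a p.1 p.2)
      (Set.uIcc u₁ u₂ ×ˢ Set.uIcc (-S) S) := by
    intro p hp
    apply ContinuousAt.continuousWithinAt
    have h1 : ContinuousAt (fun p : ℝ × ℝ => WS α γ a p.1 p.2) p := by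
      unfold WS wf
      have := hc _ hp.1
      fun_prop (disch := assumption)
    exact (continuousAt_const.mul (Complex.continuous_ofReal.continuousAt.comp h1)).mul
      (diff_FF α γ a p (hc _ hp.1)).continuousAt
  have main := integral2_divergence_prod_of_hasFDerivAt_off_countable f g (fderiv ℝ f) (fderiv ℝ g)
    u₁ (-S) u₂ S ∅ Set.countable_empty
    (fun p hp => (dF p hp).continuousAt.continuousWithinAt)
    (fun p hp => (dG p hp).continuousAt.continuousWithinAt)
    (fun p hp => (dF p (hsub p hp)).hasFDerivAt) (fun p hp => (dG p (hsub p hp)).hasFDerivAt)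
    (((hcont.integrableOn_compact (isCompact_uIcc.prod isCompact_uIcc))).congr_fun
      (fun p hp => (hdiv p hp).symm) (measurableSet_uIcc.prod measurableSet_uIcc))
  rw [← main]
  refine intervalIntegral.integral_congr fun u hu => ?_
  refine intervalIntegral.integral_congr fun s hs' => ?_
  exact (hdiv (u, s) ⟨hu, hs'⟩).symm

end CMS

namespace CMS
open Filter Topology

lemma image_exp (α b : ℝ) (hα : 0 < α) (hb : 0 < b) :
    (fun s : ℝ => b * Real.exp (α * s)) '' Set.univ = Set.Ioi 0 := by
  ext x
  simp only [Set.image_univ, Set.mem_range, Set.mem_Ioi]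
  constructor
  · rintro ⟨s, rfl⟩; positivity
  · intro hx
    refine ⟨Real.log (x / b) / α, ?_⟩
    rw [mul_div_cancel₀ _ hα.ne', Real.exp_log (by positivity)]
    field_simp

lemma hasDeriv_exp (α b : ℝ) (s : ℝ) :
    HasDerivAt (fun s : ℝ => b * Real.exp (α * s)) (α * (b * Real.exp (α * s))) s := by
  have : HasDerivAt (fun s : ℝ => α * s) α s := by
    simpa using ((hasDerivAt_id s).const_mul α)
  refine (this.exp.const_mul b).congr_deriv ?_
  ring

lemma inj_exp (α b : ℝ) (hα : 0 < α) (hb : 0 < b) :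
    Set.InjOn (fun s : ℝ => b * Real.exp (α * s)) Set.univ := by
  intro x _ y _ h
  have h1 := mul_left_cancel₀ hb.ne' h
  exact mul_left_cancel₀ hα.ne' (Real.exp_injective h1)

lemma cov_integral (α b : ℝ) (hα : 0 < α) (hb : 0 < b) (g : ℝ → ℂ) :
    ∫ x in Set.Ioi 0, g x =
      ∫ s : ℝ, (α * (b * Real.exp (α * s))) • g (b * Real.exp (α * s)) := by
  rw [← image_exp α b hα hb, integral_image_eq_integral_abs_deriv_smul MeasurableSet.univ
    (fun s _ => (hasDeriv_exp α b s).hasDerivWithinAt) (inj_exp α b hα hb), setIntegral_univ]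
  congr 1; ext s
  rw [abs_of_pos (by positivity)]

lemma cov_integrable (α b : ℝ) (hα : 0 < α) (hb : 0 < b) (g : ℝ → ℂ) 
    (hg : IntegrableOn g (Set.Ioi 0)) :
    Integrable fun s : ℝ => (α * (b * Real.exp (α * s))) • g (b * Real.exp (α * s)) := by
  rw [← image_exp α b hα hb, integrableOn_image_iff_integrableOn_abs_deriv_smul MeasurableSet.univ
    (fun s _ => (hasDeriv_exp α b s).hasDerivWithinAt) (inj_exp α b hα hb), integrableOn_univ] at hg
  refine hg.congr (Eventually.of_forall fun s => ?_)
  simp only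
  rw [abs_of_pos (by positivity)]

lemma meas_WSFF (α γ a : ℝ) :
    Measurable (fun p : ℝ × ℝ => (WS α γ a p.1 p.2 : ℂ) * FF α γ a p.1 p.2) := by
  unfold WS FF wf cf
  fun_prop

lemma meas_FF (α γ a : ℝ) : Measurable (fun p : ℝ × ℝ => FF α γ a p.1 p.2) := by
  unfold FF wf cf
  fun_prop

lemma meas_MM : Measurable (fun p : ℝ × ℝ => MM p.1 p.2) := by
  unfold MM DD
  fun_prop

lemma meas_NN : Measurable (fun p : ℝ × ℝ => NN p.1 p.2) := by
  unfold NN DD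
  fun_prop

lemma norm_WSFF (α γ a u s : ℝ) (hα : 0 < α) (ha : 0 < a) (hw : 0 < wf α γ u) :
    ‖(WS α γ a u s : ℂ) * FF α γ a u s‖ = 
      α * (a * wf α γ u * Real.exp (α * s)) * Real.exp (-(a * wf α γ u * Real.exp (α * s))) := by
  rw [norm_mul, norm_FF, Complex.norm_real, Real.norm_of_nonneg (by unfold WS; positivity), WS]
  ring_nf

lemma integrable_norm_WSFF (α γ a u : ℝ) (hα : 0 < α) (ha : 0 < a) (hw : 0 < wf α γ u) :
    Integrable (fun s => ‖(WS α γ a u s : ℂ) * FF α γ a u s‖) ∧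
      ∫ s, ‖(WS α γ a u s : ℂ) * FF α γ a u s‖ = 1 := by
  have hb : 0 < a * wf α γ u := by positivity
  have h1 := cov_integrable α _ hα hb (fun x => (Real.exp (-x) : ℂ))
    (Integrable.ofReal (𝕜 := ℂ) (integrableOn_exp_neg_Ioi 0))
  have h2 := cov_integral α _ hα hb (fun x => (Real.exp (-x) : ℂ))
  simp only [norm_WSFF α γ a u _ hα ha hw]
  constructor
  · refine h1.re.congr (Eventually.of_forall fun s => ?_)
    simp only [Complex.real_smul, ← Complex.ofReal_mul, RCLike.re_eq_complex_re, Complex.ofReal_re]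
  · simp only [Complex.real_smul, ← Complex.ofReal_mul, integral_complex_ofReal] at h2
    have h3 := Complex.ofReal_injective h2
    rw [← h3, integral_exp_neg_Ioi_zero]

lemma integrable_WSFF (α γ a u : ℝ) (hα : 0 < α) (ha : 0 < a) (hw : 0 < wf α γ u) :
    Integrable (fun s => (WS α γ a u s : ℂ) * FF α γ a u s) := by
  rw [← integrable_norm_iff]
  · exact (integrable_norm_WSFF α γ a u hα ha hw).1
  · exact ((meas_WSFF α γ a).comp (measurable_prodMk_left (x := u))).aestronglyMeasurable

lemma cosh_ge (s : ℝ) : (1 + s ^ 2) / 2 ≤ Real.cosh s := by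
  have h : Real.cosh s = 1 + 2 * Real.sinh (s / 2) ^ 2 := by
    have := Real.cosh_two_mul (s / 2)
    rw [Real.cosh_sq] at this
    rw [show s = 2 * (s / 2) by ring, this]; ring_nf
  have h2 : (s / 2) ^ 2 ≤ Real.sinh (s / 2) ^ 2 := by
    rw [sq_le_sq, Real.abs_sinh]
    exact Real.self_le_sinh_iff.2 (abs_nonneg _)
  rw [h]; nlinarith

lemma integrable_inv_cosh : Integrable (fun s : ℝ => (Real.cosh s)⁻¹) := by
  refine (integrable_inv_one_add_sq.const_mul 2).mono' 
    (Real.continuous_cosh.measurable.inv.aestronglyMeasurable) (Eventually.of_forall fun s => ?_)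
  rw [Real.norm_of_nonneg (inv_nonneg.2 (Real.cosh_pos s).le)]
  have := cosh_ge s
  calc (Real.cosh s)⁻¹ ≤ ((1 + s ^ 2) / 2)⁻¹ := inv_anti₀ (by positivity) this
    _ = 2 * (1 + s ^ 2)⁻¹ := by rw [inv_div]; ring

lemma tendsto_inv_cosh : Tendsto (fun s : ℝ => (Real.cosh s)⁻¹) atTop (𝓝 0) := by
  apply Tendsto.inv_tendsto_atTop
  refine tendsto_atTop_mono cosh_ge ?_
  apply Tendsto.atTop_div_const (by norm_num)
  exact tendsto_atTop_add_const_left _ _ (tendsto_pow_atTop (by norm_num))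

lemma norm_MM_le (u s : ℝ) (hu : Real.sin u ≠ 0) :
    ‖MM u s‖ ≤ |Real.sin u|⁻¹ * (Real.cosh s)⁻¹ := by
  rw [MM, norm_div, Complex.norm_real, ← mul_inv, ← one_div]
  have := Real.cosh_pos s
  have h2 := abs_pos.2 hu
  gcongr
  · exact Real.abs_cos_le_one u
  · exact cosh_le_DD u s

lemma norm_NN_neg (u S : ℝ) (hS : 0 ≤ S) (hu : Real.sin u ≠ 0) :
    ‖NN u (-S)‖ ≤ 2 * (|Real.sin u|⁻¹ * (Real.cosh S)⁻¹) := by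
  rw [NN, norm_div, ← mul_inv, ← div_eq_mul_inv]
  have := Real.cosh_pos S
  have h2 := abs_pos.2 hu
  have h3 := cosh_le_DD u (-S)
  rw [Real.cosh_neg] at h3
  gcongr
  refine (norm_add_le _ _).trans ?_
  rw [norm_mul, Complex.norm_I, Complex.norm_real, Complex.norm_real, one_mul, Real.norm_eq_abs,
    Real.norm_eq_abs, Real.abs_exp]
  have h4 : Real.exp (-S) ≤ 1 := by simpa using hS
  linarith [Real.abs_sin_le_one u]

lemma norm_NN_pos (u S : ℝ) (hS : 0 ≤ S) (hu : Real.sin u ≠ 0) :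
    ‖NN u S - 2‖ ≤ 2 * (|Real.sin u|⁻¹ * (Real.cosh S)⁻¹) := by
  have hD : DD u S ≠ 0 := DD_ne hu
  have e : NN u S - 2 = ((Real.exp (-S) : ℂ) - I * (Real.sin u : ℂ)) / DD u S := by
    rw [NN, div_sub' hD]
    congr 1
    have := congrArg Complex.ofReal (Real.sinh_eq S)
    rw [DD, this]
    push_cast
    ring
  rw [e, norm_div, ← mul_inv, ← div_eq_mul_inv]
  have := Real.cosh_pos S
  have h2 := abs_pos.2 hu
  have h3 := cosh_le_DD u S
  gcongr
  refine (norm_sub_le _ _).trans ?_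
  rw [norm_mul, Complex.norm_I, Complex.norm_real, Complex.norm_real, one_mul, Real.norm_eq_abs,
    Real.norm_eq_abs, Real.abs_exp]
  have h4 : Real.exp (-S) ≤ 1 := by simpa using hS
  linarith [Real.abs_sin_le_one u]

lemma tendsto_FF (α γ a u : ℝ) (hα : 0 < α) (ha : 0 < a) (hw : 0 < wf α γ u) :
    Tendsto (fun s => FF α γ a u s) atTop (𝓝 0) := by
  rw [tendsto_zero_iff_norm_tendsto_zero]
  simp only [norm_FF]
  refine Real.tendsto_exp_neg_atTop_nhds_zero.comp ?_
  apply Tendsto.atTop_mul_const hw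
  apply Tendsto.const_mul_atTop ha
  exact Real.tendsto_exp_atTop.comp (tendsto_id.const_mul_atTop hα)

end CMS

namespace CMS
open Filter Topology

noncomputable def JJ (α γ a u : ℝ) : ℂ := ∫ s : ℝ, (WS α γ a u s : ℂ) * FF α γ a u s
noncomputable def KK (α γ a : ℝ) (F0 : ℂ) (u : ℝ) : ℂ := ∫ s : ℝ, (FF α γ a u s - F0) * MM u s

lemma norm_G_le (α γ a u s : ℝ) (F0 : ℂ) (ha : 0 < a) (hw : 0 < wf α γ u) (h0 : ‖F0‖ ≤ 1) :
    ‖FF α γ a u s - F0‖ ≤ 2 := by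
  refine (norm_sub_le _ _).trans ?_
  have := norm_FF_le α γ a u s ha.le hw.le
  linarith

lemma integrable_GM (α γ a u : ℝ) (F0 : ℂ) (ha : 0 < a) (hw : 0 < wf α γ u) (h0 : ‖F0‖ ≤ 1)
    (hs : Real.sin u ≠ 0) : Integrable fun s : ℝ => (FF α γ a u s - F0) * MM u s := by
  refine (integrable_inv_cosh.const_mul (2 * |Real.sin u|⁻¹)).mono' ?_
    (Eventually.of_forall fun s => ?_)
  · exact ((((meas_FF α γ a).sub_const F0).mul meas_MM).comp
      (measurable_prodMk_left (x := u))).aestronglyMeasurable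
  · rw [norm_mul, mul_assoc]
    exact mul_le_mul (norm_G_le α γ a u s F0 ha hw h0) (norm_MM_le u s hs) (norm_nonneg _)
      (by norm_num)

lemma norm_JJ_le (α γ a u : ℝ) (hα : 0 < α) (ha : 0 < a) (hw : 0 < wf α γ u) :
    ‖JJ α γ a u‖ ≤ 1 :=
  (norm_integral_le_integral_norm _).trans (integrable_norm_WSFF α γ a u hα ha hw).2.le

lemma meas_JJ (α γ a : ℝ) : StronglyMeasurable (JJ α γ a) :=
  (meas_WSFF α γ a).stronglyMeasurable.integral_prod_right

lemma limit_identity (α γ a : ℝ) (F0 : ℂ) (u₁ u₂ : ℝ) (hα : 0 < α) (ha : 0 < a) (h0 : ‖F0‖ ≤ 1)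
    (hc : ∀ u ∈ Set.uIcc u₁ u₂, Real.cos u ≠ 0) (hs : ∀ u ∈ Set.uIcc u₁ u₂, Real.sin u ≠ 0)
    (hw : ∀ u ∈ Set.uIcc u₁ u₂, 0 < wf α γ u) :
    ∫ u in u₁..u₂, -2 * JJ α γ a u =
      (∫ _u in u₁..u₂, -2 * F0) + (I * KK α γ a F0 u₂ - I * KK α γ a F0 u₁) := by
  have hΙ : ∀ u ∈ Set.uIoc u₁ u₂, u ∈ Set.uIcc u₁ u₂ := fun u hu => Set.uIoc_subset_uIcc hu
  have hneg : Tendsto (fun S : ℝ => -S) atTop atBot := tendsto_neg_atTop_atBot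
  have hK : ∀ u ∈ Set.uIcc u₁ u₂, Tendsto
      (fun S : ℝ => ∫ s in (-S)..S, I * ((FF α γ a u s - F0) * MM u s)) atTop
      (𝓝 (I * KK α γ a F0 u)) := by
    intro u hu
    rw [KK, ← integral_const_mul]
    exact intervalIntegral_tendsto_integral
      ((integrable_GM α γ a u F0 ha (hw u hu) h0 (hs u hu)).const_mul I) hneg tendsto_id
  have hbint : IntervalIntegrable (fun u => 2 * (2 + 2 * |Real.sin u|⁻¹)) volume u₁ u₂ := by
    apply ContinuousOn.intervalIntegrable
    intro u hu
    have := abs_ne_zero.2 (hs u hu)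
    apply ContinuousAt.continuousWithinAt
    fun_prop (disch := assumption)
  have hcosh : ∀ S : ℝ, (Real.cosh S)⁻¹ ≤ 1 := fun S => inv_le_one_of_one_le₀ (Real.one_le_cosh S)
  have hNp : Tendsto (fun S : ℝ => ∫ u in u₁..u₂, (FF α γ a u S - F0) * NN u S) atTop
      (𝓝 (∫ _u in u₁..u₂, -2 * F0)) := by
    refine intervalIntegral.tendsto_integral_filter_of_dominated_convergence
      (fun u => 2 * (2 + 2 * |Real.sin u|⁻¹)) ?_ ?_ hbint ?_
    · refine Eventually.of_forall fun S => ?_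
      exact ((((meas_FF α γ a).sub_const F0).mul meas_NN).comp
        (measurable_prodMk_right (y := S))).aestronglyMeasurable
    · filter_upwards [eventually_ge_atTop 0] with S hS
      refine Eventually.of_forall fun u hu => ?_
      have hu' := hΙ u hu
      rw [norm_mul]
      refine mul_le_mul (norm_G_le α γ a u S F0 ha (hw u hu') h0) ?_ (norm_nonneg _) (by norm_num)
      have h1 := norm_NN_pos u S hS (hs u hu')
      have h2 : ‖NN u S‖ ≤ ‖NN u S - 2‖ + ‖(2 : ℂ)‖ := by
        simpa using norm_add_le (NN u S - 2) 2
      have h3 : |Real.sin u|⁻¹ * (Real.cosh S)⁻¹ ≤ |Real.sin u|⁻¹ * 1 :=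
        mul_le_mul_of_nonneg_left (hcosh S) (inv_nonneg.2 (abs_nonneg _))
      have h4 : ‖(2 : ℂ)‖ = 2 := by simp
      linarith
    · refine Eventually.of_forall fun u hu => ?_
      have hu' := hΙ u hu
      have h1 : Tendsto (fun S => NN u S - 2) atTop (𝓝 0) := by
        rw [tendsto_zero_iff_norm_tendsto_zero]
        refine squeeze_zero' (Eventually.of_forall fun _ => norm_nonneg _)
          ((eventually_ge_atTop 0).mono fun S hS => norm_NN_pos u S hS (hs u hu')) ?_
        simpa using (tendsto_inv_cosh.const_mul |Real.sin u|⁻¹).const_mul 2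
      have h2 : Tendsto (fun S => NN u S) atTop (𝓝 2) := by simpa using h1.add_const 2
      have h3 := ((tendsto_FF α γ a u hα ha (hw u hu')).sub_const F0).mul h2
      convert h3 using 2
      ring
  have hNm : Tendsto (fun S : ℝ => ∫ u in u₁..u₂, (FF α γ a u (-S) - F0) * NN u (-S)) atTop
      (𝓝 (∫ _u in u₁..u₂, (0 : ℂ))) := by
    refine intervalIntegral.tendsto_integral_filter_of_dominated_convergence
      (fun u => 2 * (2 + 2 * |Real.sin u|⁻¹)) ?_ ?_ hbint ?_
    · refine Eventually.of_forall fun S => ?_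
      exact ((((meas_FF α γ a).sub_const F0).mul meas_NN).comp
        (measurable_prodMk_right (y := -S))).aestronglyMeasurable
    · filter_upwards [eventually_ge_atTop 0] with S hS
      refine Eventually.of_forall fun u hu => ?_
      have hu' := hΙ u hu
      rw [norm_mul]
      refine mul_le_mul (norm_G_le α γ a u (-S) F0 ha (hw u hu') h0) ?_ (norm_nonneg _)
        (by norm_num)
      have h1 := norm_NN_neg u S hS (hs u hu')
      have h3 : |Real.sin u|⁻¹ * (Real.cosh S)⁻¹ ≤ |Real.sin u|⁻¹ * 1 :=
        mul_le_mul_of_nonneg_left (hcosh S) (inv_nonneg.2 (abs_nonneg _))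
      linarith
    · refine Eventually.of_forall fun u hu => ?_
      have hu' := hΙ u hu
      rw [tendsto_zero_iff_norm_tendsto_zero]
      refine squeeze_zero' (g := fun S => 2 * (2 * (|Real.sin u|⁻¹ * (Real.cosh S)⁻¹)))
          (Eventually.of_forall fun _ => norm_nonneg _)
          ((eventually_ge_atTop 0).mono fun S hS => ?_) ?_
      · rw [norm_mul]
        exact mul_le_mul (norm_G_le α γ a u (-S) F0 ha (hw u hu') h0)
          (norm_NN_neg u S hS (hs u hu')) (norm_nonneg _) (by norm_num)
      · simpa using ((tendsto_inv_cosh.const_mul |Real.sin u|⁻¹).const_mul 2).const_mul 2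
  have hJ : Tendsto (fun S : ℝ => ∫ u in u₁..u₂, ∫ s in (-S)..S,
      -2 * (WS α γ a u s : ℂ) * FF α γ a u s) atTop (𝓝 (∫ u in u₁..u₂, -2 * JJ α γ a u)) := by
    simp only [mul_assoc, intervalIntegral.integral_const_mul]
    refine Tendsto.const_mul _ ?_
    refine intervalIntegral.tendsto_integral_filter_of_dominated_convergence
      (fun u => 1) ?_ ?_ intervalIntegrable_const ?_
    · filter_upwards [eventually_ge_atTop 0] with S hS
      simp only [intervalIntegral.integral_of_le (show -S ≤ S by linarith)]
      exact (StronglyMeasurable.integral_prod_right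
        (meas_WSFF α γ a).stronglyMeasurable).aestronglyMeasurable
    · filter_upwards [eventually_ge_atTop 0] with S hS
      refine Eventually.of_forall fun u hu => ?_
      have hu' := hΙ u hu
      have hi := integrable_norm_WSFF α γ a u hα ha (hw u hu')
      rw [intervalIntegral.integral_of_le (show -S ≤ S by linarith), ← hi.2]
      refine (norm_integral_le_integral_norm _).trans ?_
      exact setIntegral_le_integral hi.1 (Eventually.of_forall fun _ => norm_nonneg _)
    · refine Eventually.of_forall fun u hu => ?_
      exact intervalIntegral_tendsto_integral
        (integrable_WSFF α γ a u hα ha (hw u (hΙ u hu))) hneg tendsto_id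
  have hR := ((hNp.sub hNm).add (hK u₂ Set.right_mem_uIcc)).sub (hK u₁ Set.left_mem_uIcc)
  have := tendsto_nhds_unique (hJ.congr fun S => divergence α γ a F0 u₁ u₂ S hc hs) hR
  rw [this]
  simp only [intervalIntegral.integral_zero]
  ring

end CMS

namespace CMS
open Filter Topology

lemma norm_MM_le' (u s : ℝ) (hu : Real.sin u ≠ 0) :
    ‖MM u s‖ ≤ |Real.cos u| * |Real.sin u|⁻¹ * (Real.cosh s)⁻¹ := by
  rw [MM, norm_div, Complex.norm_real, mul_assoc, ← mul_inv, ← div_eq_mul_inv, Real.norm_eq_abs]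
  have := Real.cosh_pos s
  have h2 := abs_pos.2 hu
  gcongr
  exact cosh_le_DD u s

lemma norm_KK_le (α γ a u : ℝ) (F0 : ℂ) (ha : 0 < a) (hw : 0 < wf α γ u) (h0 : ‖F0‖ ≤ 1)
    (hs : Real.sin u ≠ 0) :
    ‖KK α γ a F0 u‖ ≤ 2 * (|Real.cos u| * |Real.sin u|⁻¹) * ∫ s : ℝ, (Real.cosh s)⁻¹ := by
  rw [← integral_const_mul]
  refine norm_integral_le_of_norm_le (integrable_inv_cosh.const_mul _)
    (Eventually.of_forall fun s => ?_)
  rw [norm_mul, mul_assoc]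
  exact mul_le_mul (norm_G_le α γ a u s F0 ha hw h0) (norm_MM_le' u s hs) (norm_nonneg _)
      (by norm_num)

lemma inv_sinh_le {δ s : ℝ} (hδ : 0 < δ) (hs : δ ≤ |s|) :
    |Real.sinh s|⁻¹ ≤ Real.cosh δ / Real.sinh δ * (Real.cosh s)⁻¹ := by
  have h1 : 0 < Real.sinh δ := Real.sinh_pos_iff.2 hδ
  have h2 := Real.cosh_pos s
  have h3 : 0 ≤ Real.sinh (|s| - δ) := Real.sinh_nonneg_iff.2 (by linarith)
  rw [Real.sinh_sub, Real.cosh_abs] at h3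
  have h4 : 0 < Real.sinh |s| := Real.sinh_pos_iff.2 (by linarith)
  rw [Real.abs_sinh, ← div_eq_mul_inv, div_div, ← one_div, div_le_div_iff₀ h4 (by positivity)]
  linarith

lemma le_DD {u s : ℝ} (hu : |u| ≤ π / 2) : max |u| |s| ≤ π / 2 * ‖DD u s‖ := by
  have hπ := Real.pi_pos
  apply max_le
  · have h1 := Real.mul_abs_le_abs_sin hu
    have h2 := sin_le_DD u s
    have h3 : 2 / π * |u| ≤ ‖DD u s‖ := h1.trans h2
    calc |u| = π / 2 * (2 / π * |u|) := by field_simp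
      _ ≤ _ := by gcongr
  · have h1 : |s| ≤ |Real.sinh s| := by
      rw [Real.abs_sinh]; exact Real.self_le_sinh_iff.2 (abs_nonneg _)
    have h2 := h1.trans (sinh_le_DD u s)
    have h3 : 1 ≤ π / 2 := by linarith [Real.two_le_pi]
    nlinarith [norm_nonneg (DD u s)]

lemma bound_near_zero (α γ a : ℝ) (ha : 0 < a)
    (hw : ∀ u ∈ Set.Ioo (-(π / 2)) (π / 2), 0 < wf α γ u) (h0 : ‖FF α γ a 0 0‖ ≤ 1) :
    ∃ C : ℝ, ∀ᶠ u in 𝓝 (0 : ℝ), ∀ s : ℝ,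
      ‖(FF α γ a u s - FF α γ a 0 0) * MM u s‖ ≤ C * (Real.cosh s)⁻¹ := by
  have hO := (diff_FF α γ a (0, 0) (by simp)).isBigO_sub
  obtain ⟨c, hc, hb⟩ := hO.exists_pos
  rw [Asymptotics.isBigOWith_iff, Metric.eventually_nhds_iff] at hb
  obtain ⟨δ, hδ, hb⟩ := hb
  have hπ := Real.pi_pos
  have hch : 0 < Real.cosh δ := Real.cosh_pos δ
  have hsh : 0 < Real.sinh δ := Real.sinh_pos_iff.2 hδ
  refine ⟨max (c * (π / 2) * Real.cosh δ) (2 * (Real.cosh δ / Real.sinh δ)), ?_⟩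
  have hε : 0 < min δ (π / 2) := lt_min hδ (by positivity)
  filter_upwards [Metric.ball_mem_nhds (0 : ℝ) hε] with u hu s
  rw [Metric.mem_ball, dist_zero_right, Real.norm_eq_abs, lt_min_iff] at hu
  have hcs := Real.cosh_pos s
  have hM : ‖MM u s‖ ≤ 1 / ‖DD u s‖ := by
    rw [MM, norm_div, Complex.norm_real]
    gcongr
    exact Real.abs_cos_le_one u
  rw [norm_mul]
  rcases lt_or_ge |s| δ with hs | hs
  · have h1 := @hb (u, s) (by
      rw [Prod.dist_eq, Real.dist_eq, Real.dist_eq, sub_zero, sub_zero]; exact max_lt hu.1 hs)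
    simp only [Prod.mk_sub_mk, sub_zero, Prod.norm_mk, Real.norm_eq_abs] at h1
    have h2 := le_DD (s := s) hu.2.le
    calc ‖FF α γ a u s - FF α γ a 0 0‖ * ‖MM u s‖
        ≤ (c * max |u| |s|) * (1 / ‖DD u s‖) := by gcongr
      _ = c * max |u| |s| / ‖DD u s‖ := by rw [mul_one_div]
      _ ≤ c * (π / 2) := by
          apply div_le_of_le_mul₀ (norm_nonneg _) (by positivity)
          rw [mul_assoc]; gcongr
      _ = c * (π / 2) * Real.cosh s * (Real.cosh s)⁻¹ := by field_simp
      _ ≤ c * (π / 2) * Real.cosh δ * (Real.cosh s)⁻¹ := by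
          have : Real.cosh s ≤ Real.cosh δ := Real.cosh_le_cosh.2 (by
            rw [abs_of_pos hδ]; exact hs.le)
          gcongr
      _ ≤ _ := by gcongr; exact le_max_left _ _
  · have h1 := norm_G_le α γ a u s (FF α γ a 0 0) ha (hw u (abs_lt.1 hu.2)) h0
    have hs0 : 0 < |Real.sinh s| := by
      rw [Real.abs_sinh]; exact Real.sinh_pos_iff.2 (by linarith)
    have h2 : ‖MM u s‖ ≤ Real.cosh δ / Real.sinh δ * (Real.cosh s)⁻¹ := by
      refine hM.trans (le_trans ?_ (inv_sinh_le hδ hs))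
      rw [← one_div]
      gcongr
      exact sinh_le_DD u s
    calc ‖FF α γ a u s - FF α γ a 0 0‖ * ‖MM u s‖
        ≤ 2 * (Real.cosh δ / Real.sinh δ * (Real.cosh s)⁻¹) := by gcongr
      _ = 2 * (Real.cosh δ / Real.sinh δ) * (Real.cosh s)⁻¹ := by ring
      _ ≤ _ := by gcongr; exact le_max_right _ _

lemma continuousAt_KK (α γ a : ℝ) (ha : 0 < a)
    (hw : ∀ u ∈ Set.Ioo (-(π / 2)) (π / 2), 0 < wf α γ u) (h0 : ‖FF α γ a 0 0‖ ≤ 1) :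
    ContinuousAt (KK α γ a (FF α γ a 0 0)) 0 := by
  obtain ⟨C, hC⟩ := bound_near_zero α γ a ha hw h0
  refine continuousAt_of_dominated (bound := fun s => C * (Real.cosh s)⁻¹) ?_ ?_
    (integrable_inv_cosh.const_mul C) ?_
  · refine Eventually.of_forall fun u => ?_
    exact ((((meas_FF α γ a).sub_const _).mul meas_MM).comp
      (measurable_prodMk_left (x := u))).aestronglyMeasurable
  · filter_upwards [hC] with u hu
    exact Eventually.of_forall hu
  · have : ∀ᵐ s : ℝ, s ≠ 0 := by simp [ae_iff]
    filter_upwards [this] with s hs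
    have h1 := (diff_FF α γ a (0, s) (by simp)).continuousAt
    have h2 := (diff_MM (0, s) (DD_ne' hs)).continuousAt
    have h3 : ContinuousAt (fun u : ℝ => (u, s)) 0 := by fun_prop
    exact ContinuousAt.comp (g := fun p : ℝ × ℝ => (FF α γ a p.1 p.2 - FF α γ a 0 0) * MM p.1 p.2)
      (f := fun u : ℝ => (u, s)) ((h1.sub continuousAt_const).mul h2) h3

lemma wf_zero (α γ : ℝ) : wf α γ 0 = Real.cos γ := by simp [wf]

lemma core (α γ a : ℝ) (hα : 0 < α) (ha : 0 < a)
    (hw : ∀ u ∈ Set.Ioo (-(π / 2)) (π / 2), 0 < wf α γ u) :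
    ∫ u in (-(π / 2))..(π / 2), JJ α γ a u = π * FF α γ a 0 0 := by
  have hπ := Real.pi_pos
  have h0 : ‖FF α γ a 0 0‖ ≤ 1 :=
    norm_FF_le α γ a 0 0 ha.le (hw 0 ⟨by linarith, by linarith⟩).le
  set F0 := FF α γ a 0 0 with hF0
  have hJint : IntervalIntegrable (JJ α γ a) volume (-(π / 2)) (π / 2) := by
    rw [intervalIntegrable_iff, Set.uIoc_of_le (by linarith), integrableOn_Ioc_iff_integrableOn_Ioo]
    refine Measure.integrableOn_of_bounded (M := 1) (by simp)
      (meas_JJ α γ a).aestronglyMeasurable ?_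
    filter_upwards [ae_restrict_mem measurableSet_Ioo] with u hu
    exact norm_JJ_le α γ a u hα ha (hw u hu)
  have hfint : IntervalIntegrable (fun u => -2 * JJ α γ a u - -2 * F0) volume (-(π / 2)) (π / 2) :=
    (hJint.const_mul _).sub intervalIntegrable_const
  have hsubint : ∀ x y, x ∈ Set.Icc (-(π / 2)) (π / 2) → y ∈ Set.Icc (-(π / 2)) (π / 2) →
      Set.uIcc x y ⊆ Set.uIcc (-(π / 2)) (π / 2) := by
    intro x y hx hy
    rw [Set.uIcc_of_le (show -(π / 2) ≤ π / 2 by linarith)]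
    exact Set.uIcc_subset_Icc hx hy
  set P : ℝ → ℂ := fun x => ∫ u in (0 : ℝ)..x, (-2 * JJ α γ a u - -2 * F0) with hP
  have hz : (0 : ℝ) ∈ Set.Icc (-(π / 2)) (π / 2) := ⟨by linarith, by linarith⟩
  have hPcont : ContinuousOn P (Set.Icc (-(π / 2)) (π / 2)) := by
    rw [← Set.uIcc_of_le (show -(π / 2) ≤ π / 2 by linarith)]
    exact intervalIntegral.continuousOn_primitive_interval' hfint
      (by rw [Set.uIcc_of_le (show -(π / 2) ≤ π / 2 by linarith)]; exact hz)
  have hside : ∀ ε : ℝ, (ε = 1 ∨ ε = -1) → P (ε * (π / 2)) = -(I * KK α γ a F0 0) := by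
    intro ε hε
    have hmem : ∀ x ∈ Set.Icc (0 : ℝ) (π / 2), ε * x ∈ Set.Icc (-(π / 2)) (π / 2) := by
      intro x hx
      rcases hε with rfl | rfl
      · constructor <;> linarith [hx.1, hx.2]
      · constructor <;> linarith [hx.1, hx.2]
    have hu : ∀ x ∈ Set.Ioo (0 : ℝ) (π / 2), ∀ y ∈ Set.Ioo (0 : ℝ) (π / 2),
        ∀ u ∈ Set.uIcc (ε * x) (ε * y), u ∈ Set.Ioo (-(π / 2)) (π / 2) ∧ u ≠ 0 := by
      intro x hx y hy u hu
      rw [Set.mem_uIcc] at hu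
      rcases hε with rfl | rfl
      · have h1 : 0 < u := by rcases hu with h | h <;> linarith [hx.1, hy.1, h.1, h.2]
        have h2 : u < π / 2 := by rcases hu with h | h <;> linarith [hx.2, hy.2, h.1, h.2]
        exact ⟨⟨by linarith, h2⟩, h1.ne'⟩
      · have h1 : u < 0 := by rcases hu with h | h <;> linarith [hx.1, hy.1, h.1, h.2]
        have h2 : -(π / 2) < u := by rcases hu with h | h <;> linarith [hx.2, hy.2, h.1, h.2]
        exact ⟨⟨h2, by linarith⟩, h1.ne⟩
    have hsin : ∀ u ∈ Set.Ioo (-(π / 2)) (π / 2), u ≠ 0 → Real.sin u ≠ 0 := fun u hu hu0 h =>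
      hu0 ((Real.sin_eq_zero_iff_of_lt_of_lt (by linarith [hu.1]) (by linarith [hu.2])).1 h)
    have hconst : ∀ x ∈ Set.Ioo (0 : ℝ) (π / 2), ∀ y ∈ Set.Ioo (0 : ℝ) (π / 2),
        P (ε * y) - I * KK α γ a F0 (ε * y) = P (ε * x) - I * KK α γ a F0 (ε * x) := by
      intro x hx y hy
      have hx' := hmem x (Set.Ioo_subset_Icc_self hx)
      have hy' := hmem y (Set.Ioo_subset_Icc_self hy)
      have h1 := limit_identity α γ a F0 (ε * x) (ε * y) hα ha h0
        (fun u h => (Real.cos_pos_of_mem_Ioo (hu x hx y hy u h).1).ne')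
        (fun u h => hsin u (hu x hx y hy u h).1 (hu x hx y hy u h).2)
        (fun u h => hw u (hu x hx y hy u h).1)
      have h2 : P (ε * y) - P (ε * x) =
          ∫ u in (ε * x)..(ε * y), (-2 * JJ α γ a u - -2 * F0) :=
        intervalIntegral.integral_interval_sub_left (hfint.mono_set (hsubint _ _ hz hy'))
          (hfint.mono_set (hsubint _ _ hz hx'))
      rw [intervalIntegral.integral_sub ((hJint.const_mul _).mono_set (hsubint _ _ hx' hy'))
        intervalIntegrable_const, h1] at h2
      linear_combination h2
    have h1mem : (1 : ℝ) ∈ Set.Ioo (0 : ℝ) (π / 2) := ⟨one_pos, by linarith [Real.pi_gt_three]⟩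
    have hmul : Continuous (fun x : ℝ => ε * x) := by fun_prop
    have hPε : ContinuousOn (fun x => P (ε * x)) (Set.Icc 0 (π / 2)) :=
      hPcont.comp hmul.continuousOn hmem
    have hT0 : Tendsto (fun x => P (ε * x) - I * KK α γ a F0 (ε * x)) (𝓝[>] 0)
        (𝓝 (P 0 - I * KK α γ a F0 0)) := by
      refine Tendsto.sub ?_ (Tendsto.const_mul _ ?_)
      · have := (hPε 0 ⟨le_rfl, by positivity⟩).mono_left
          (nhdsWithin_le_of_mem (Icc_mem_nhdsGT (show (0 : ℝ) < π / 2 by positivity)))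
        simpa using this
      · have h := continuousAt_KK α γ a ha hw h0
        have h' : Tendsto (fun x : ℝ => ε * x) (𝓝[>] 0) (𝓝 0) := by
          simpa using (hmul.tendsto 0).mono_left nhdsWithin_le_nhds
        exact h.tendsto.comp h'
    have hT1 : Tendsto (fun x => P (ε * x) - I * KK α γ a F0 (ε * x)) (𝓝[<] (π / 2))
        (𝓝 (P (ε * (π / 2)) - I * 0)) := by
      refine Tendsto.sub ?_ (Tendsto.const_mul _ ?_)
      · exact (hPε (π / 2) ⟨by positivity, le_rfl⟩).mono_left
          (nhdsWithin_le_of_mem (Icc_mem_nhdsLT (show (0 : ℝ) < π / 2 by positivity)))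
      · rw [tendsto_zero_iff_norm_tendsto_zero]
        refine squeeze_zero' (g := fun x => 2 * (|Real.cos (ε * x)| * |Real.sin (ε * x)|⁻¹) *
          ∫ s : ℝ, (Real.cosh s)⁻¹) (Eventually.of_forall fun _ => norm_nonneg _) ?_ ?_
        · filter_upwards [Ioo_mem_nhdsLT (show (0 : ℝ) < π / 2 by positivity)] with x hx
          have := hu x hx x hx (ε * x) Set.left_mem_uIcc
          exact norm_KK_le α γ a _ F0 ha (hw _ this.1) h0 (hsin _ this.1 this.2)
        · have hs : |Real.sin (ε * (π / 2))| ≠ 0 := by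
            rcases hε with rfl | rfl <;> simp
          have hc : Real.cos (ε * (π / 2)) = 0 := by
            rcases hε with rfl | rfl <;> simp
          have : ContinuousAt (fun x => 2 * (|Real.cos (ε * x)| * |Real.sin (ε * x)|⁻¹) *
            ∫ s : ℝ, (Real.cosh s)⁻¹) (π / 2) := by
            fun_prop (disch := assumption)
          have h' := this.tendsto.mono_left (nhdsWithin_le_nhds (s := Set.Iio (π / 2)))
          simpa [hc] using h'
    have e0 := tendsto_nhds_unique hT0 ((tendsto_const_nhds
      (x := P (ε * 1) - I * KK α γ a F0 (ε * 1))).congr' (by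
        filter_upwards [Ioo_mem_nhdsGT (show (0 : ℝ) < π / 2 by positivity)] with x hx
        exact hconst x hx 1 h1mem))
    have e1 := tendsto_nhds_unique hT1 ((tendsto_const_nhds
      (x := P (ε * 1) - I * KK α γ a F0 (ε * 1))).congr' (by
        filter_upwards [Ioo_mem_nhdsLT (show (0 : ℝ) < π / 2 by positivity)] with x hx
        exact hconst x hx 1 h1mem))
    have hP0 : P 0 = 0 := by simp [hP]
    rw [hP0] at e0
    linear_combination e1 - e0
  have hp := hside 1 (Or.inl rfl)
  have hm := hside (-1) (Or.inr rfl)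
  rw [one_mul] at hp
  rw [neg_one_mul] at hm
  have htot : P (π / 2) - P (-(π / 2)) =
      ∫ u in (-(π / 2))..(π / 2), (-2 * JJ α γ a u - -2 * F0) :=
    intervalIntegral.integral_interval_sub_left
      (hfint.mono_set (hsubint _ _ hz ⟨by linarith, le_rfl⟩))
      (hfint.mono_set (hsubint _ _ hz ⟨le_rfl, by linarith⟩))
  rw [hp, hm, sub_self, intervalIntegral.integral_sub (hJint.const_mul _) intervalIntegrable_const,
    intervalIntegral.integral_const_mul, intervalIntegral.integral_const] at htot
  simp only [sub_neg_eq_add, add_halves, Complex.real_smul] at htot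
  linear_combination (1 / 2) * htot

end CMS

namespace CMS
open Filter Topology

lemma abs_arctan_le {y θ : ℝ} (h0 : 0 ≤ θ) (h1 : θ < π / 2) (h : |y| ≤ Real.tan θ) :
    |Real.arctan y| ≤ θ := by
  have h2 := abs_le.1 h
  have e : Real.arctan (Real.tan θ) = θ := Real.arctan_tan (by linarith [Real.pi_pos]) h1
  rw [abs_le]
  constructor
  · have := Real.arctan_mono h2.1
    rwa [Real.arctan_neg, e] at this
  · have := Real.arctan_mono h2.2
    rwa [e] at this

lemma gamma_bound (α β : ℝ) (hα : α ∈ Set.Ioc (0 : ℝ) 2) (hα1 : α ≠ 1)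
    (hβ : β ∈ Set.Icc (-1 : ℝ) 1) :
    |Real.arctan (β * Real.tan (π * α / 2))| ≤ (1 - |α - 1|) * (π / 2) := by
  have hπ := Real.pi_pos
  have hb : |β| ≤ 1 := abs_le.2 hβ
  rcases lt_or_gt_of_ne hα1 with h | h
  · rw [abs_of_neg (by linarith : α - 1 < 0)]
    have h1 : 0 ≤ π * α / 2 := by have := hα.1; positivity
    have h2 : π * α / 2 < π / 2 := by nlinarith
    have ht := Real.tan_nonneg_of_nonneg_of_le_pi_div_two h1 h2.le
    refine (abs_arctan_le h1 h2 ?_).trans_eq (by ring)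
    rw [abs_mul, abs_of_nonneg ht]
    nlinarith
  · rw [abs_of_pos (by linarith : 0 < α - 1)]
    have h1 : 0 ≤ π - π * α / 2 := by nlinarith [hα.2]
    have h2 : π - π * α / 2 < π / 2 := by nlinarith
    have ht := Real.tan_nonneg_of_nonneg_of_le_pi_div_two h1 h2.le
    refine (abs_arctan_le h1 h2 ?_).trans_eq (by ring)
    have e : Real.tan (π * α / 2) = - Real.tan (π - π * α / 2) := by
      rw [Real.tan_pi_sub, neg_neg]
    rw [e, abs_mul, abs_neg, abs_of_nonneg ht]
    nlinarith

lemma wf_pos (α γ : ℝ) (hα1 : α ≠ 1) (hγ : |γ| ≤ (1 - |α - 1|) * (π / 2)) :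
    ∀ u ∈ Set.Ioo (-(π / 2)) (π / 2), 0 < wf α γ u := by
  intro u hu
  have h1 : |u| < π / 2 := abs_lt.2 hu
  have h2 : 0 < |α - 1| := abs_pos.2 (sub_ne_zero.2 hα1)
  have h3 : |(α - 1) * u + γ| < π / 2 := by
    refine (abs_add_le _ _).trans_lt ?_
    rw [abs_mul]
    nlinarith
  exact div_pos (Real.cos_pos_of_mem_Ioo (abs_lt.1 h3)) (Real.cos_pos_of_mem_Ioo hu)

/-- The CMS map in terms of `γ = α T`. -/
noncomputable def YY (α γ x u : ℝ) : ℝ :=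
  Real.sin (α * u + γ) / (Real.cos γ * Real.cos u) ^ (1 / α) *
    (Real.cos (γ + (α - 1) * u) / x) ^ ((1 - α) / α)

lemma meas_YY (α γ : ℝ) : Measurable (fun p : ℝ × ℝ => YY α γ p.1 p.2) := by
  unfold YY
  fun_prop

lemma YY_eq (α γ τ u s : ℝ) (hα : 0 < α) (hτ : 0 < τ) (hγ : 0 < Real.cos γ) (hu : 0 < Real.cos u)
    (hw : 0 < wf α γ u) :
    τ * YY α γ (τ ^ α / Real.cos γ * wf α γ u * Real.exp (α * s)) u =
      τ ^ α / Real.cos γ * Real.exp ((α - 1) * s) * cf α γ u := by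
  have hC : 0 < Real.cos ((α - 1) * u + γ) := by
    have := mul_pos hw hu
    rwa [wf, div_mul_cancel₀ _ hu.ne'] at this
  have hτα : 0 < τ ^ α := Real.rpow_pos_of_pos hτ α
  set q := Real.cos γ * Real.cos u with hq
  have hqp : 0 < q := by positivity
  set r := τ * Real.exp s with hr
  have hrp : 0 < r := by positivity
  have e1 : Real.cos (γ + (α - 1) * u) / (τ ^ α / Real.cos γ * wf α γ u * Real.exp (α * s))
      = q / r ^ α := by
    rw [hr, Real.mul_rpow hτ.le (Real.exp_pos s).le, ← Real.exp_mul, mul_comm s α, wf, add_comm γ,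
      hq]
    field_simp
  have e2 : (q / r ^ α) ^ ((1 - α) / α) = q ^ (1 / α) / q * r ^ (α - 1) := by
    rw [Real.div_rpow hqp.le (by positivity), ← Real.rpow_mul hrp.le, div_eq_mul_inv,
      ← Real.rpow_neg hrp.le]
    congr 1
    · rw [show (1 - α) / α = 1 / α - 1 by field_simp, Real.rpow_sub_one hqp.ne']
    · congr 1; field_simp; ring
  have e3 : r ^ (α - 1) = τ ^ α / τ * Real.exp ((α - 1) * s) := by
    rw [hr, Real.mul_rpow hτ.le (Real.exp_pos s).le, ← Real.exp_mul, mul_comm s,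
      Real.rpow_sub_one hτ.ne']
  have hq1 : 0 < q ^ (1 / α) := Real.rpow_pos_of_pos hqp _
  rw [YY, e1, e2, e3, cf, ← hq]
  have : q ^ (1 / α) ≠ 0 := hq1.ne'
  generalize q ^ (1 / α) = z at *
  rw [hq]
  field_simp

lemma JJ_eq (α γ τ u : ℝ) (hα : 0 < α) (hτ : 0 < τ) (hγ : 0 < Real.cos γ) (hu : 0 < Real.cos u)
    (hw : 0 < wf α γ u) :
    JJ α γ (τ ^ α / Real.cos γ) u =
      ∫ x in Set.Ioi (0 : ℝ), (Real.exp (-x)) • Complex.exp (I * ((-τ : ℝ) : ℂ) * (YY α γ x u : ℂ)) := by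
  have ha : 0 < τ ^ α / Real.cos γ := div_pos (Real.rpow_pos_of_pos hτ α) hγ
  rw [cov_integral α (τ ^ α / Real.cos γ * wf α γ u) hα (by positivity), JJ]
  congr 1; ext s
  have h := YY_eq α γ τ u s hα hτ hγ hu hw
  have h' : I * ((-τ : ℝ) : ℂ) *
      (YY α γ (τ ^ α / Real.cos γ * wf α γ u * Real.exp (α * s)) u : ℂ) =
      -(I * ((τ ^ α / Real.cos γ * Real.exp ((α - 1) * s) * cf α γ u : ℝ) : ℂ)) := by
    rw [← h]; push_cast; ring
  rw [h', Complex.real_smul, Complex.real_smul, Complex.ofReal_exp, ← Complex.exp_add, WS, FF]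
  congr 2
  · ring
  · push_cast; ring

instance : IsProbabilityMeasure expOne := by
  constructor
  rw [expOne, withDensity_apply _ MeasurableSet.univ, Measure.restrict_univ,
    ← ofReal_integral_eq_lintegral_ofReal (integrableOn_exp_neg_Ioi 0)
      (Eventually.of_forall fun x => (Real.exp_pos _).le), integral_exp_neg_Ioi_zero]
  simp

instance : IsProbabilityMeasure unifHalfPi := by
  constructor
  rw [unifHalfPi, Measure.smul_apply, Measure.restrict_apply_univ, Real.volume_Ioo, smul_eq_mul,
    ← ENNReal.ofReal_mul (by positivity)]
  have : π⁻¹ * (π / 2 - -(π / 2)) = 1 := by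
    have := Real.pi_pos.ne'
    field_simp; ring
  rw [this]; simp

lemma charFunc_eq (α γ t : ℝ) :
    charFunc (Measure.map (fun p : ℝ × ℝ => YY α γ p.1 p.2) (expOne.prod unifHalfPi)) t =
      π⁻¹ • ∫ u in Set.Ioo (-(π / 2)) (π / 2), ∫ x in Set.Ioi (0 : ℝ),
        (Real.exp (-x)) • Complex.exp (I * (t : ℂ) * (YY α γ x u : ℂ)) := by
  rw [charFunc, integral_map (meas_YY α γ).aemeasurable (by fun_prop), integral_prod_symm]
  · rw [unifHalfPi, integral_smul_measure, ENNReal.toReal_ofReal (by positivity)]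
    congr 1
    congr 1; ext u
    rw [expOne, integral_withDensity_eq_integral_toReal_smul (by fun_prop) (by simp)]
    congr 1; ext x
    rw [ENNReal.toReal_ofReal (Real.exp_pos _).le]
  · refine Integrable.of_bound (C := 1) ?_ (Eventually.of_forall fun p => ?_)
    · have := meas_YY α γ
      exact Measurable.aestronglyMeasurable (by fun_prop)
    · rw [mul_assoc, mul_comm, ← Complex.ofReal_mul, Complex.norm_exp_ofReal_mul_I]

lemma charFunc_neg (α γ τ : ℝ) (hα : 0 < α) (hτ : 0 < τ)
    (hw : ∀ u ∈ Set.Ioo (-(π / 2)) (π / 2), 0 < wf α γ u) :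
    charFunc (Measure.map (fun p : ℝ × ℝ => YY α γ p.1 p.2) (expOne.prod unifHalfPi)) (-τ) =
      Complex.exp (-((τ ^ α : ℝ) : ℂ) * (1 + I * (Real.tan γ : ℂ))) := by
  have hπ := Real.pi_pos
  have hγ : 0 < Real.cos γ := by
    have := hw 0 ⟨by linarith, by linarith⟩
    rwa [wf_zero] at this
  have ha : 0 < τ ^ α / Real.cos γ := div_pos (Real.rpow_pos_of_pos hτ α) hγ
  rw [charFunc_eq]
  have h1 := core α γ _ hα ha hw
  rw [intervalIntegral.integral_of_le (by linarith), integral_Ioc_eq_integral_Ioo] at h1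
  have h2 : ∫ u in Set.Ioo (-(π / 2)) (π / 2), ∫ x in Set.Ioi (0 : ℝ),
        (Real.exp (-x)) • Complex.exp (I * ((-τ : ℝ) : ℂ) * (YY α γ x u : ℂ)) =
      ∫ u in Set.Ioo (-(π / 2)) (π / 2), JJ α γ (τ ^ α / Real.cos γ) u :=
    setIntegral_congr_fun measurableSet_Ioo fun u hu =>
      (JJ_eq α γ τ u hα hτ hγ (Real.cos_pos_of_mem_Ioo hu) (hw u hu)).symm
  rw [h2, h1, Complex.real_smul, ← mul_assoc, ← Complex.ofReal_mul, inv_mul_cancel₀ hπ.ne',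
    Complex.ofReal_one, one_mul, FF, wf_zero]
  have hc : cf α γ 0 = Real.sin γ := by simp [cf]
  rw [hc]
  congr 1
  have e1 : τ ^ α / Real.cos γ * Real.exp (α * 0) * Real.cos γ = τ ^ α := by
    simp; field_simp
  have e2 : τ ^ α / Real.cos γ * Real.exp ((α - 1) * 0) * Real.sin γ = τ ^ α * Real.tan γ := by
    rw [Real.tan_eq_sin_div_cos]; simp; field_simp
  rw [e1, e2]
  push_cast
  ring

lemma charFunc_conj (P : Measure ℝ) (t : ℝ) :
    charFunc P t = (starRingEnd ℂ) (charFunc P (-t)) := by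
  rw [charFunc, charFunc, ← integral_conj]
  congr 1; ext x
  rw [← Complex.exp_conj]
  congr 1
  simp

end CMS

/-- Chambers–Mallows–Stuck: for `α ≠ 1`, the pushforward of `Exp(1) ⊗ U(-π/2,π/2)` under the
CMS map has the `α`-stable characteristic function `exp(-|t|^α (1 - i β tan(πα/2) sgn t))`. -/
theorem cms_alpha_ne_one (α β : ℝ) (hα : α ∈ Set.Ioc (0 : ℝ) 2) (hα1 : α ≠ 1)
    (hβ : β ∈ Set.Icc (-1 : ℝ) 1) :
    let T : ℝ := (1 / α) * Real.arctan (β * Real.tan (π * α / 2))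
    ∀ t : ℝ,
      charFunc
        (Measure.map
          (fun p : ℝ × ℝ =>
            Real.sin (α * (p.2 + T)) / (Real.cos (α * T) * Real.cos p.2) ^ (1 / α) *
              (Real.cos (α * T + (α - 1) * p.2) / p.1) ^ ((1 - α) / α))
          (expOne.prod unifHalfPi)) t =
      Complex.exp (-(|t| ^ α : ℝ) *
        (1 - Complex.I * (β : ℂ) * (Real.tan (π * α / 2) : ℂ) * (Real.sign t : ℂ))) := by
  intro T t
  set γ := Real.arctan (β * Real.tan (π * α / 2)) with hγ
  have hT : α * T = γ := by
    have := hα.1.ne'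
    simp only [T]
    rw [← hγ, ← mul_assoc, mul_one_div_cancel this, one_mul]
  have hw := CMS.wf_pos α γ hα1 (CMS.gamma_bound α β hα hα1 hβ)
  have hfun : (fun p : ℝ × ℝ =>
            Real.sin (α * (p.2 + T)) / (Real.cos (α * T) * Real.cos p.2) ^ (1 / α) *
              (Real.cos (α * T + (α - 1) * p.2) / p.1) ^ ((1 - α) / α)) =
      fun p : ℝ × ℝ => CMS.YY α γ p.1 p.2 := by
    ext p
    rw [CMS.YY, mul_add, hT]
  rw [hfun]
  have htan : Real.tan γ = β * Real.tan (π * α / 2) := Real.tan_arctan _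
  have hmul : (β : ℂ) * (Real.tan (π * α / 2) : ℂ) = (Real.tan γ : ℂ) := by
    rw [htan]; push_cast; ring
  rw [mul_assoc Complex.I, hmul]
  rcases lt_trichotomy t 0 with ht | ht | ht
  · have h := CMS.charFunc_neg α γ (-t) hα.1 (by linarith) hw
    rw [neg_neg] at h
    rw [h, abs_of_neg ht, Real.sign_of_neg ht]
    congr 1
    push_cast; ring
  · subst ht
    have := Measure.isProbabilityMeasure_map (μ := expOne.prod unifHalfPi)
      (CMS.meas_YY α γ).aemeasurable
    simp [charFunc, Real.zero_rpow hα.1.ne']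
  · rw [CMS.charFunc_conj, CMS.charFunc_neg α γ t hα.1 ht hw, abs_of_pos ht, Real.sign_of_pos ht,
      ← Complex.exp_conj]
    congr 1
    simp only [map_mul, map_neg, map_add, map_one, Complex.conj_ofReal, Complex.conj_I]
    push_cast; ring
end

section
/- Let β ∈ [−1,1]. Let W be distributed according to the exponential distribution with rate 1 on (0,∞) and let U be distributed uniformly on (−π/2, π/2), independently. Then the random variable Ȳ = (2/π)·[ (π/2 + β·U)·tan U − β·log( (π/2)·W·cos U / (π/2 + β·U) ) ] has characteristic function t ↦ exp(−|t|·(1 + i·β·(2/π)·sgn(t)·log|t|)) (with the integrand understood as 1 at t = 0). Equivalently, the pushforward of Exp(1) ⊗ Uniform(−π/2,π/2) under the map (w,u) ↦ (2/π)[(π/2+βu)tan u − β log((π/2) w cos u/(π/2+βu))] has this characteristic function. -/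
open MeasureTheory Real Complex

lemma cms_norm_cpow_le {z : ℂ} (hz : 0 < z.re) (w : ℂ) :
    ‖z ^ w‖ ≤ ‖z‖ ^ w.re * Real.exp (π * |w.im|) := by
  have h0 : z ≠ 0 := by rintro rfl; simp at hz
  rw [Complex.norm_cpow_of_ne_zero h0, div_eq_mul_inv, ← Real.exp_neg]
  gcongr
  have h1 := Complex.abs_arg_le_pi z
  calc -(z.arg * w.im) ≤ |z.arg * w.im| := neg_le_abs _
    _ = |z.arg| * |w.im| := abs_mul _ _
    _ ≤ _ := by gcongr

lemma cms_integrableOn_gamma {z r : ℂ} (hz : 0 < z.re) (hr : 0 < r.re) :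
    IntegrableOn (fun t : ℝ => (t : ℂ) ^ (z - 1) * Complex.exp (-(r * t))) (Set.Ioi 0) := by
  have h := integrableOn_rpow_mul_exp_neg_mul_rpow (p := 1) (s := z.re - 1) (b := r.re)
    (by linarith) one_pos hr
  refine Integrable.mono' h ?_ ?_
  · refine ContinuousOn.aestronglyMeasurable ?_ measurableSet_Ioi
    refine ContinuousOn.mul ?_ (by fun_prop)
    intro t ht
    exact (Complex.continuousAt_ofReal_cpow_const _ _ (Or.inr (ne_of_gt ht))).continuousWithinAt
  · refine (ae_restrict_iff' measurableSet_Ioi).2 (Filter.Eventually.of_forall fun t ht => ?_)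
    rw [norm_mul, Complex.norm_cpow_eq_rpow_re_of_pos ht, Complex.norm_exp]
    simp

lemma cms_gammaLap {z : ℂ} (hz : 0 < z.re) {r : ℂ} (hr : 0 < r.re) :
    ∫ t : ℝ in Set.Ioi 0, (t : ℂ) ^ (z - 1) * Complex.exp (-(r * t)) =
      Complex.Gamma z * r ^ (-z) := by
  set U : Set ℂ := {r | 0 < r.re} with hU
  have hUo : IsOpen U := isOpen_lt continuous_const Complex.continuous_re
  have hUc : Convex ℝ U := convex_halfSpace_re_gt 0
  have d1 : DifferentiableOn ℂ (fun r : ℂ => ∫ t : ℝ in Set.Ioi 0,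
      (t : ℂ) ^ (z - 1) * Complex.exp (-(r * t))) U := by
    intro r hr
    have hr : 0 < r.re := hr
    refine DifferentiableAt.differentiableWithinAt ?_
    have hmem : Metric.ball r (r.re / 2) ∈ nhds r := Metric.ball_mem_nhds _ (by linarith)
    refine (hasDerivAt_integral_of_dominated_loc_of_deriv_le
      (μ := volume.restrict (Set.Ioi 0))
      (F := fun (r : ℂ) (t : ℝ) => (t : ℂ) ^ (z - 1) * Complex.exp (-(r * t)))
      (F' := fun (r : ℂ) (t : ℝ) => (t : ℂ) ^ (z - 1) * (Complex.exp (-(r * t)) * (-t)))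
      (bound := fun t : ℝ => t ^ (z.re) * Real.exp (-(r.re / 2) * t ^ (1 : ℝ)))
      hmem ?_ (cms_integrableOn_gamma hz hr) ?_ ?_ ?_ ?_).2.differentiableAt
    · filter_upwards [hUo.mem_nhds hr] with x hx
      exact (cms_integrableOn_gamma hz hx).1
    · have := (cms_integrableOn_gamma hz hr).1
      have h2 : AEStronglyMeasurable (fun t : ℝ => -(t : ℂ)) (volume.restrict (Set.Ioi 0)) := by
        fun_prop
      convert! this.mul h2 using 1
      ext t
      simp [mul_assoc]
    · refine (ae_restrict_iff' measurableSet_Ioi).2 (Filter.Eventually.of_forall fun t ht => ?_)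
      intro x hx
      have ht : 0 < t := ht
      have hre : r.re / 2 < x.re := by
        have := (Complex.abs_re_le_norm (x - r)).trans_lt (mem_ball_iff_norm.1 hx)
        rw [abs_lt] at this
        simp at this
        linarith
      rw [norm_mul, norm_mul, Complex.norm_cpow_eq_rpow_re_of_pos ht, Complex.norm_exp, norm_neg,
        Complex.norm_real, Real.norm_of_nonneg ht.le]
      have : t ^ z.re = t ^ (z - 1).re * t := by
        rw [← Real.rpow_add_one ht.ne']; simp
      rw [this]
      have e : (-(x * t)).re ≤ -(r.re / 2) * t ^ (1 : ℝ) := by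
        simp
        nlinarith
      have := Real.exp_le_exp.2 e
      have hp := Real.rpow_nonneg ht.le (z - 1).re
      calc _ = t ^ (z - 1).re * t * Real.exp (-(x * t)).re := by ring
        _ ≤ _ := by gcongr
    · exact integrableOn_rpow_mul_exp_neg_mul_rpow (by linarith) one_pos (by linarith)
    · refine Filter.Eventually.of_forall fun t x hx => ?_
      have : HasDerivAt (fun x : ℂ => -(x * (t : ℂ))) (-(t : ℂ)) x := by
        simpa using (hasDerivAt_id x).mul_const (-(t : ℂ))
      exact (this.cexp).const_mul _
  have d2 : DifferentiableOn ℂ (fun r : ℂ => Complex.Gamma z * r ^ (-z)) U := by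
    intro r hr
    have hr : 0 < r.re := hr
    exact (((hasDerivAt_id r).cpow_const (Or.inl hr)).differentiableAt.const_mul
      _).differentiableWithinAt
  have key := (d1.analyticOnNhd hUo).eqOn_of_preconnected_of_frequently_eq
    (d2.analyticOnNhd hUo) hUc.isPreconnected (z₀ := 1) (by simp [hU]) ?_
  · exact key hr
  · have ht : Filter.Tendsto (fun n : ℕ => ((1 + 1 / ((n : ℝ) + 1) : ℝ) : ℂ)) Filter.atTop
        (nhdsWithin 1 {1}ᶜ) := by
      refine tendsto_nhdsWithin_iff.2 ⟨?_, ?_⟩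
      · have := (tendsto_one_div_add_atTop_nhds_zero_nat (𝕜 := ℝ)).const_add 1
        rw [add_zero] at this
        have h2 := (Complex.continuous_ofReal.tendsto 1).comp this
        simpa only [Complex.ofReal_one, Function.comp_def] using h2
      · refine Filter.Eventually.of_forall fun n => ?_
        have : (0 : ℝ) < 1 / ((n : ℝ) + 1) := by positivity
        simp only [Set.mem_compl_iff, Set.mem_singleton_iff]
        intro h
        have : (1 + 1 / ((n : ℝ) + 1) : ℝ) = 1 := by exact_mod_cast h
        linarith
    refine ht.frequently (Filter.Eventually.frequently (Filter.Eventually.of_forall fun n => ?_))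
    have hp : (0 : ℝ) < 1 + 1 / ((n : ℝ) + 1) := by positivity
    generalize (1 + 1 / ((n : ℝ) + 1) : ℝ) = x at hp
    rw [Complex.integral_cpow_mul_exp_neg_mul_Ioi hz hp, mul_comm, one_div, Complex.cpow_neg,
      Complex.inv_cpow]
    rw [Complex.arg_ofReal_of_nonneg hp.le]
    exact Real.pi_pos.ne

/-- The Gamma-type density used for Fourier inversion. -/
noncomputable def cmsDens (z : ℂ) (x : ℝ) : ℂ :=
  (Set.Ioi (0 : ℝ)).indicator (fun x : ℝ => (x : ℂ) ^ (z - 1) * Complex.exp (-x)) x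

lemma cms_integrable_line (z : ℂ) (hz : z.re = 2) :
    Integrable (fun y : ℝ => (1 + y * Complex.I : ℂ) ^ (-z)) := by
  refine Integrable.mono' (integrable_inv_one_add_sq.mul_const (Real.exp (π * |(-z).im|))) ?_ ?_
  · refine Continuous.aestronglyMeasurable ?_
    refine continuous_iff_continuousAt.2 fun y => ?_
    have h : ContinuousAt (fun y : ℝ => (1 + y * Complex.I : ℂ)) y := by fun_prop
    exact h.cpow continuousAt_const (Or.inl (by simp))
  · refine Filter.Eventually.of_forall fun y => ?_
    refine (cms_norm_cpow_le (by simp) _).trans_eq ?_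
    congr 1
    rw [Complex.neg_re, hz, Real.rpow_neg (norm_nonneg _)]
    congr 1
    have := Complex.sq_norm (1 + y * Complex.I : ℂ)
    rw [Real.rpow_two, this, Complex.normSq_apply]
    simp
    ring

lemma cms_inversion (z : ℂ) (hz : z.re = 2) (q : ℝ) :
    ∫ y : ℝ, Complex.exp (q * (1 + y * Complex.I)) * (1 + y * Complex.I : ℂ) ^ (-z) =
      2 * π * Complex.exp q * cmsDens z q / Complex.Gamma z := by
  have hz0 : 0 < z.re := by linarith
  have hG : Complex.Gamma z ≠ 0 := Complex.Gamma_ne_zero_of_re_pos hz0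
  have hI : Integrable (cmsDens z) := by
    have := cms_integrableOn_gamma hz0 (r := 1) (by simp)
    simp only [one_mul] at this
    exact this.integrable_indicator measurableSet_Ioi
  have hF : ∀ w : ℝ, FourierTransform.fourier (cmsDens z) w =
      Complex.Gamma z * (1 + (2 * π * w : ℝ) * Complex.I : ℂ) ^ (-z) := by
    intro w
    rw [Real.fourier_real_eq_integral_exp_smul, ← cms_gammaLap hz0 (by simp),
      ← integral_indicator measurableSet_Ioi]
    congr 1
    ext x
    by_cases hx : 0 < x
    · rw [cmsDens, Set.indicator_of_mem (Set.mem_Ioi.2 hx), Set.indicator_of_mem (Set.mem_Ioi.2 hx),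
        smul_eq_mul, mul_left_comm, ← Complex.exp_add]
      congr 2
      push_cast
      ring
    · have : x ∉ Set.Ioi (0 : ℝ) := hx
      rw [cmsDens, Set.indicator_of_notMem this, Set.indicator_of_notMem this, smul_zero]
  have hF' : FourierTransform.fourier (cmsDens z) =
      fun w : ℝ => Complex.Gamma z * (1 + (2 * π * w : ℝ) * Complex.I : ℂ) ^ (-z) := funext hF
  have hc : ContinuousAt (cmsDens z) q := by
    have : cmsDens z = fun x : ℝ => ((max x 0 : ℝ) : ℂ) ^ (z - 1) * Complex.exp (-x) := by
      ext x
      by_cases hx : 0 < x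
      · rw [cmsDens, Set.indicator_of_mem (Set.mem_Ioi.2 hx), max_eq_left hx.le]
      · have h' : x ∉ Set.Ioi (0 : ℝ) := hx
        rw [cmsDens, Set.indicator_of_notMem h', max_eq_right (not_lt.1 hx), Complex.ofReal_zero,
          Complex.zero_cpow, zero_mul]
        intro h
        have := congrArg Complex.re h
        simp [hz] at this
        norm_num at this
    rw [this]
    refine Continuous.continuousAt ?_
    refine Continuous.mul ?_ (by fun_prop)
    refine (Complex.continuous_ofReal_cpow_const (y := z - 1) (by simp [hz])).comp (by fun_prop)
  have hFI : Integrable (FourierTransform.fourier (cmsDens z)) := by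
    rw [hF']
    exact ((cms_integrable_line z hz).comp_mul_left' (by positivity : (2 * π) ≠ 0)).const_mul _
  have inv := hI.fourierInv_fourier_eq hFI hc
  rw [Real.fourierInv_eq', hF'] at inv
  have hs := Measure.integral_comp_mul_left (fun y : ℝ =>
    Complex.exp (q * (1 + y * Complex.I)) * (1 + y * Complex.I : ℂ) ^ (-z)) (2 * π)
  have h2 : ∫ (v : ℝ), Complex.exp (↑(2 * π * inner ℝ v q) * I) •
      (fun w : ℝ => Complex.Gamma z * (1 + ((2 * π * w : ℝ) : ℂ) * I) ^ (-z)) v =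
      Complex.Gamma z * Complex.exp (-q) * ∫ x : ℝ, Complex.exp (q * (1 + (2 * π * x : ℝ) * Complex.I))
        * (1 + (2 * π * x : ℝ) * Complex.I : ℂ) ^ (-z) := by
    rw [← integral_const_mul]
    congr 1
    ext x
    have : Complex.exp (↑(2 * π * inner ℝ x q) * I) =
        Complex.exp (-q) * Complex.exp (q * (1 + (2 * π * x : ℝ) * Complex.I)) := by
      rw [← Complex.exp_add]
      congr 1
      simp
      ring
    rw [this, smul_eq_mul]
    ring
  rw [h2, hs, abs_of_pos (by positivity), Complex.real_smul] at inv
  rw [← inv, Complex.exp_neg]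
  have := Complex.exp_ne_zero q
  have hpi : (π : ℂ) ≠ 0 := by exact_mod_cast Real.pi_ne_zero
  generalize (∫ y : ℝ, Complex.exp (q * (1 + y * Complex.I)) * (1 + y * Complex.I : ℂ) ^ (-z)) = J
  push_cast
  field_simp


lemma cms_primitive (b q : ℝ) (hq : q ≠ 0) : ∃ P : ℂ → ℂ,
    (∀ ζ : ℂ, 0 < ζ.re → HasDerivAt P (Complex.exp (q * ζ) * ζ ^ (-1 + b * I)) ζ) ∧
    ∀ (l : Filter ℝ) [l.IsCountablyGenerated] (ζ ω : ℝ → ℂ) (M : ℝ),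
      (∀ᶠ u in l, 0 < (ζ u).re ∧ (ζ u).re ≤ M) → (∀ᶠ u in l, 0 < (ω u).re ∧ (ω u).re ≤ M) →
      Filter.Tendsto (fun u => (ζ u).im) l Filter.atTop →
      Filter.Tendsto (fun u => (ω u).im) l Filter.atBot →
      Filter.Tendsto (fun u => P (ζ u) - P (ω u)) l
        (nhds ((1 - b * I) / q * (I * (2 * π * Complex.exp q * cmsDens (2 - b * I) q
          / Complex.Gamma (2 - b * I))))) := by
  set U : Set ℂ := {r | 0 < r.re} with hU
  have hUo : IsOpen U := isOpen_lt continuous_const Complex.continuous_re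
  have hUc : Convex ℝ U := convex_halfSpace_re_gt 0
  have hexp : ∀ ζ : ℂ, HasDerivAt (fun ζ : ℂ => Complex.exp (q * ζ)) (Complex.exp (q * ζ) * q) ζ := by
    intro ζ
    have : HasDerivAt (fun ζ : ℂ => (q : ℂ) * ζ) q ζ := by
      simpa using (hasDerivAt_id ζ).const_mul (q : ℂ)
    exact this.cexp
  have hpow : ∀ (w ζ : ℂ), 0 < ζ.re → HasDerivAt (fun ζ : ℂ => ζ ^ w) (w * ζ ^ (w - 1)) ζ := by
    intro w ζ h
    simpa using (hasDerivAt_id ζ).cpow_const (c := w) (Or.inl h)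
  obtain ⟨P₂, hP₂⟩ : ∃ g : ℂ → ℂ, ∀ a ∈ U, HasDerivWithinAt g
      (Complex.exp (q * a) * a ^ (-(2 - b * I))) U a := by
    refine hUc.exists_forall_hasDerivWithinAt (f := fun a : ℂ =>
      Complex.exp (q * a) * a ^ (-(2 - b * I))) ?_
    intro a ha
    exact ((hexp a).mul (hpow _ a ha)).differentiableAt.differentiableWithinAt
  have hP₂' : ∀ a : ℂ, 0 < a.re → HasDerivAt P₂ (Complex.exp (q * a) * a ^ (-(2 - b * I))) a :=
    fun a ha => (hP₂ a ha).hasDerivAt (hUo.mem_nhds ha)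
  have hqc : (q : ℂ) ≠ 0 := by exact_mod_cast hq
  set κ : ℂ := -1 + b * I with hκ
  set P : ℂ → ℂ := fun ζ => (Complex.exp (q * ζ) * ζ ^ κ) / q - κ / q * P₂ ζ with hP
  have hPd : ∀ ζ : ℂ, 0 < ζ.re → HasDerivAt P (Complex.exp (q * ζ) * ζ ^ κ) ζ := by
    intro ζ h
    have := (((hexp ζ).mul (hpow κ ζ h)).div_const (q : ℂ)).sub ((hP₂' ζ h).const_mul (κ / q))
    convert! this using 1
    have e : κ - 1 = -(2 - b * I) := by rw [hκ]; ring
    rw [e]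
    field_simp
    ring
  refine ⟨P, hPd, ?_⟩
  -- decay estimate
  have hest : ∀ M : ℝ, ∃ C : ℝ, ∀ ζ : ℂ, 0 < ζ.re → ζ.re ≤ M → 1 ≤ |ζ.im| →
      ‖P ζ + κ / q * P₂ (1 + ζ.im * I)‖ ≤ C * |ζ.im|⁻¹ := by
    intro M
    refine ⟨Real.exp (|q| * M) * Real.exp (π * |b|) / |q| +
      ‖κ / q‖ * (Real.exp (|q| * (M + 1)) * Real.exp (π * |b|) * (M + 1)), ?_⟩
    intro ζ h0 hM h1
    have hM0 : 0 < M := h0.trans_le hM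
    have hpos : 0 < |ζ.im| := by linarith
    have hexpn : ∀ (w : ℂ) (R : ℝ), 0 < w.re → w.re ≤ R →
        ‖Complex.exp (q * w)‖ ≤ Real.exp (|q| * R) := by
      intro w R hw hR
      rw [Complex.norm_exp]
      refine Real.exp_le_exp.2 ?_
      simp only [Complex.re_ofReal_mul]
      calc q * w.re ≤ |q| * w.re := by gcongr; exact le_abs_self q
        _ ≤ _ := by gcongr
    have hnorm : ∀ (w : ℂ), w.im = ζ.im → |ζ.im| ≤ ‖w‖ := by
      intro w hw
      rw [← hw]; exact Complex.abs_im_le_norm w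
    have t1 : ‖(Complex.exp (q * ζ) * ζ ^ κ) / q‖ ≤
        Real.exp (|q| * M) * Real.exp (π * |b|) / |q| * |ζ.im|⁻¹ := by
      rw [norm_div, norm_mul, Complex.norm_real, Real.norm_eq_abs, div_mul_eq_mul_div, mul_assoc]
      gcongr
      · exact hexpn ζ M h0 hM
      · refine (cms_norm_cpow_le h0 κ).trans ?_
        have e1 : κ.re = -1 := by simp [hκ]
        have e2 : κ.im = b := by simp [hκ]
        rw [e1, e2, Real.rpow_neg_one, mul_comm]
        gcongr
        exact hnorm ζ rfl
    have t2 : ‖P₂ ζ - P₂ (1 + ζ.im * I)‖ ≤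
        (Real.exp (|q| * (M + 1)) * Real.exp (π * |b|) * |ζ.im|⁻¹) * ‖ζ - (1 + ζ.im * I)‖ := by
      set S : Set ℂ := (({w : ℂ | 0 < w.re} ∩ {w : ℂ | w.re ≤ M + 1}) ∩ {w : ℂ | w.im ≤ ζ.im}) ∩
        {w : ℂ | ζ.im ≤ w.im} with hS
      have hSc : Convex ℝ S := (((convex_halfSpace_re_gt 0).inter
        (convex_halfSpace_re_le _)).inter (convex_halfSpace_im_le _)).inter
        (convex_halfSpace_im_ge _)
      refine hSc.norm_image_sub_le_of_norm_hasDerivWithin_le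
        (f' := fun a => Complex.exp (q * a) * a ^ (-(2 - b * I))) ?_ ?_ ?_ ?_
      · intro w hw
        exact (hP₂' w hw.1.1.1).hasDerivWithinAt
      · intro w hw
        have hwim : w.im = ζ.im := le_antisymm hw.1.2 hw.2
        rw [norm_mul, mul_assoc]
        gcongr
        · exact hexpn w _ hw.1.1.1 hw.1.1.2
        · refine (cms_norm_cpow_le hw.1.1.1 _).trans ?_
          have e1 : (-(2 - b * I) : ℂ).re = -2 := by simp
          have e2 : (-(2 - b * I) : ℂ).im = b := by simp
          rw [e1, e2, mul_comm]
          gcongr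
          have hw1 := hnorm w hwim
          rw [Real.rpow_neg (norm_nonneg _), Real.rpow_two]
          refine inv_anti₀ hpos ?_
          nlinarith
      · simp [hS]; linarith
      · simp [hS]; exact ⟨h0, by linarith⟩
    have t3 : ‖ζ - (1 + ζ.im * I)‖ ≤ M + 1 := by
      have : ζ - (1 + ζ.im * I) = ((ζ.re - 1 : ℝ) : ℂ) := by
        apply Complex.ext <;> simp
      rw [this, Complex.norm_real, Real.norm_eq_abs, abs_le]
      constructor <;> linarith
    have e : P ζ + κ / q * P₂ (1 + ζ.im * I) =
        (Complex.exp (q * ζ) * ζ ^ κ) / q - κ / q * (P₂ ζ - P₂ (1 + ζ.im * I)) := by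
      simp only [hP]; ring
    rw [e]
    refine (norm_sub_le _ _).trans ?_
    rw [norm_mul, add_mul]
    refine add_le_add t1 ?_
    rw [mul_assoc]
    refine mul_le_mul_of_nonneg_left ?_ (norm_nonneg _)
    refine t2.trans ?_
    calc _ ≤ (Real.exp (|q| * (M + 1)) * Real.exp (π * |b|) * |ζ.im|⁻¹) * (M + 1) := by gcongr
      _ = _ := by ring
  intro l _ ζ ω M hζ hω hζi hωi
  have hlim : ∀ η : ℝ → ℂ, (∀ᶠ u in l, 0 < (η u).re ∧ (η u).re ≤ M) →
      Filter.Tendsto (fun u => |(η u).im|) l Filter.atTop →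
      Filter.Tendsto (fun u => P (η u) + κ / q * P₂ (1 + (η u).im * I)) l (nhds 0) := by
    intro η h1 h2
    obtain ⟨C, hC⟩ := hest M
    have h3 : Filter.Tendsto (fun u => C * |(η u).im|⁻¹) l (nhds 0) := by
      simpa using (tendsto_inv_atTop_zero.comp h2).const_mul C
    refine squeeze_zero_norm' ?_ h3
    filter_upwards [h1, h2.eventually_ge_atTop 1] with u hu hu2
    exact hC _ hu.1 hu.2 hu2
  have hz : (2 - b * I : ℂ).re = 2 := by simp
  have hIntg : Integrable (fun y : ℝ => Complex.exp (q * (1 + y * I)) *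
      (1 + y * I : ℂ) ^ (-(2 - b * I))) := by
    refine (cms_integrable_line _ hz).bdd_mul (c := Real.exp q) ?_ ?_
    · exact Continuous.aestronglyMeasurable (by fun_prop)
    · refine Filter.Eventually.of_forall fun y => ?_
      rw [Complex.norm_exp]
      simp
  have hline : Filter.Tendsto (fun u => P₂ (1 + (ζ u).im * I) - P₂ (1 + (ω u).im * I)) l
      (nhds (I * (2 * π * Complex.exp q * cmsDens (2 - b * I) q
          / Complex.Gamma (2 - b * I)))) := by
    have h1 := (intervalIntegral_tendsto_integral hIntg hωi hζi).const_mul I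
    rw [cms_inversion _ hz] at h1
    refine h1.congr fun u => ?_
    rw [← intervalIntegral.integral_const_mul]
    refine intervalIntegral.integral_eq_sub_of_hasDerivAt
      (f := fun y : ℝ => P₂ (1 + y * I)) ?_ ?_
    · intro y _
      have h2 : HasDerivAt (fun y : ℝ => (1 + y * I : ℂ)) I y := by
        simpa using ((Complex.ofRealCLM.hasDerivAt (x := y)).mul_const I).const_add 1
      have := (hP₂' (1 + y * I) (by simp)).comp y h2
      convert! this using 1
      ring
    · exact (hIntg.const_mul I).intervalIntegrable
  have f1 := hlim ζ hζ (Filter.tendsto_abs_atTop_atTop.comp hζi)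
  have f2 := hlim ω hω (Filter.tendsto_abs_atBot_atTop.comp hωi)
  have := (f1.sub f2).sub (hline.const_mul (κ / q))
  convert! this using 1
  · ext u; ring
  · congr 1
    rw [hκ]
    ring


lemma cms_measurable_tan : Measurable Real.tan := by
  have : Real.tan = fun x => Real.sin x / Real.cos x := funext Real.tan_eq_sin_div_cos
  rw [this]
  fun_prop

lemma cms_core (β s : ℝ) (hβ : |β| < 1) (hs : 0 < s) :
    ∫ u in Set.Ioo (-(π / 2)) (π / 2), Complex.exp (I * ((s * ((π / 2 + β * u) * Real.tan u) +
      β * s * Real.log (s * (π / 2 + β * u) / Real.cos u) : ℝ) : ℂ)) =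
    π * Complex.exp (-(π / 2 * s : ℝ)) / Complex.Gamma (1 - (β * s : ℝ) * I) := by
  set b : ℝ := β * s with hb
  set a : ℝ → ℝ := fun u => π / 2 + β * u with ha
  set h : ℝ → ℝ := fun u => s * (a u * Real.tan u) + b * Real.log (s * a u / Real.cos u) with hh
  have hpi := Real.pi_pos
  set m : ℝ := π / 2 * (1 - |β|) with hm
  have hm0 : 0 < m := by
    have : 0 < 1 - |β| := by linarith
    positivity
  have hβu : ∀ u ∈ Set.Ioo (-(π / 2)) (π / 2), |β * u| ≤ |β| * (π / 2) := by
    intro u hu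
    rw [abs_mul]
    have : |u| ≤ π / 2 := (abs_lt.2 hu).le
    gcongr
  have ha1 : ∀ u ∈ Set.Ioo (-(π / 2)) (π / 2), m ≤ a u := by
    intro u hu
    have := neg_le_of_abs_le (hβu u hu)
    simp only [ha, hm]; linarith
  have ha2 : ∀ u ∈ Set.Ioo (-(π / 2)) (π / 2), a u ≤ π := by
    intro u hu
    have := le_of_abs_le (hβu u hu)
    simp only [ha]
    nlinarith
  obtain ⟨P1, hP1, hL1⟩ := cms_primitive b 1 one_ne_zero
  obtain ⟨P2, hP2, hL2⟩ := cms_primitive b (-1) (by norm_num)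
  set ζ : ℝ → ℂ := fun u => (s * a u : ℝ) + (s * a u * Real.tan u : ℝ) * I with hζ
  set ω : ℝ → ℂ := fun u => (s * a u : ℝ) - (s * a u * Real.tan u : ℝ) * I with hω
  set G : ℝ → ℂ := fun u => -I * Complex.exp (-(π / 2 * s : ℝ)) * P1 (ζ u) +
    I * Complex.exp ((π / 2 * s : ℝ)) * P2 (ω u) with hG
  have hζre : ∀ u, (ζ u).re = s * a u := fun u => by simp [hζ]
  have hωre : ∀ u, (ω u).re = s * a u := fun u => by simp [hω]
  have hζim : ∀ u, (ζ u).im = s * a u * Real.tan u := fun u => by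
    simp only [hζ, Complex.add_im, Complex.mul_im, Complex.ofReal_im, Complex.ofReal_re, Complex.I_im, Complex.I_re]; ring
  have hωim : ∀ u, (ω u).im = - (s * a u * Real.tan u) := fun u => by
    simp only [hω, Complex.sub_im, Complex.mul_im, Complex.ofReal_im, Complex.ofReal_re, Complex.I_im, Complex.I_re]; ring
  have hder : ∀ u ∈ Set.Ioo (-(π / 2)) (π / 2), HasDerivAt G (2 * Complex.exp (I * (h u : ℂ))) u := by
    intro u hu
    have hc : 0 < Real.cos u := Real.cos_pos_of_mem_Ioo hu
    have hau : 0 < a u := hm0.trans_le (ha1 u hu)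
    have hsa : 0 < s * a u := by positivity
    have da : HasDerivAt (fun u => s * a u) (s * β) u := by
      have : HasDerivAt (fun u => π / 2 + β * u) β u := by
        simpa using ((hasDerivAt_id u).const_mul β).const_add (π / 2)
      exact this.const_mul s
    have dy : HasDerivAt (fun u => s * a u * Real.tan u)
        (s * β * Real.tan u + s * a u * (1 / Real.cos u ^ 2)) u :=
      da.mul (Real.hasDerivAt_tan hc.ne')
    have dζ := da.ofReal_comp.add (dy.ofReal_comp.mul_const I)
    have dω := da.ofReal_comp.sub (dy.ofReal_comp.mul_const I)
    have c1 := (hP1 (ζ u) (by rw [hζre]; exact hsa)).comp u dζ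
    have c2 := (hP2 (ω u) (by rw [hωre]; exact hsa)).comp u dω
    have dG := (c1.const_mul (-I * Complex.exp (-(π / 2 * s : ℝ)))).add
      (c2.const_mul (I * Complex.exp ((π / 2 * s : ℝ))))
    convert! dG using 1
    set ρ : ℝ := Real.log (s * a u / Real.cos u) with hρ
    have eρ : Real.exp ρ = s * a u / Real.cos u := Real.exp_log (by positivity)
    have eζ : ζ u = Complex.exp (ρ + u * I) := by
      rw [Complex.exp_add, ← Complex.ofReal_exp, eρ, Complex.exp_mul_I, ← Complex.ofReal_cos,
        ← Complex.ofReal_sin]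
      simp only [hζ, Real.tan_eq_sin_div_cos]
      have : (Real.cos u : ℂ) ≠ 0 := by exact_mod_cast hc.ne'
      push_cast
      push_cast at this
      field_simp
    have eω : ω u = Complex.exp (ρ + (-u : ℝ) * I) := by
      rw [Complex.exp_add, ← Complex.ofReal_exp, eρ, Complex.exp_mul_I, ← Complex.ofReal_cos,
        ← Complex.ofReal_sin, Real.cos_neg, Real.sin_neg]
      simp only [hω, Real.tan_eq_sin_div_cos]
      have : (Real.cos u : ℂ) ≠ 0 := by exact_mod_cast hc.ne'
      push_cast
      push_cast at this
      field_simp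
      ring
    have hζ0 : ζ u ≠ 0 := by rw [eζ]; exact Complex.exp_ne_zero _
    have hω0 : ω u ≠ 0 := by rw [eω]; exact Complex.exp_ne_zero _
    have lζ : Complex.log (ζ u) = ρ + u * I := by
      rw [eζ, Complex.log_exp] <;> simp <;> linarith [hu.1, hu.2]
    have lω : Complex.log (ω u) = ρ + (-u : ℝ) * I := by
      rw [eω, Complex.log_exp] <;> simp <;> linarith [hu.1, hu.2]
    have k1 : Complex.exp ((1 : ℝ) * ζ u) * ζ u ^ (-1 + b * I) =
        Complex.exp ((π / 2 * s : ℝ)) * Complex.exp (I * (h u : ℂ)) / ζ u := by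
      rw [Complex.cpow_def_of_ne_zero hζ0, eq_div_iff hζ0]
      nth_rw 3 [← Complex.exp_log hζ0]
      rw [lζ, ← Complex.exp_add, ← Complex.exp_add, ← Complex.exp_add]
      congr 1
      simp only [hζ, hh, ha, hb]
      push_cast
      linear_combination (β * s * u : ℂ) * I_mul_I
    have k2 : Complex.exp ((-1 : ℝ) * ω u) * ω u ^ (-1 + b * I) =
        Complex.exp (-(π / 2 * s : ℝ)) * Complex.exp (I * (h u : ℂ)) / ω u := by
      rw [Complex.cpow_def_of_ne_zero hω0, eq_div_iff hω0]
      nth_rw 3 [← Complex.exp_log hω0]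
      rw [lω, ← Complex.exp_add, ← Complex.exp_add, ← Complex.exp_add]
      congr 1
      simp only [hω, hh, ha, hb]
      push_cast
      linear_combination -(β * s * u : ℂ) * I_mul_I
    rw [k1, k2]
    have hcc : 1 / Real.cos u ^ 2 = 1 + Real.tan u ^ 2 := by
      rw [Real.tan_eq_sin_div_cos]
      field_simp
      linarith [Real.sin_sq_add_cos_sq u]
    rw [hcc]
    have v1 : ((s * β : ℝ) : ℂ) + ((s * β * Real.tan u + s * a u * (1 + Real.tan u ^ 2) : ℝ) : ℂ) * I
        = ζ u * ((β / a u + Real.tan u : ℝ) + I) := by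
      have : (a u : ℂ) ≠ 0 := by exact_mod_cast hau.ne'
      simp only [hζ]
      generalize a u = A at *
      generalize Real.tan u = T at *
      push_cast
      field_simp
      linear_combination (-(s * A * T : ℂ)) * I_sq
    have v2 : ((s * β : ℝ) : ℂ) - ((s * β * Real.tan u + s * a u * (1 + Real.tan u ^ 2) : ℝ) : ℂ) * I
        = ω u * ((β / a u + Real.tan u : ℝ) - I) := by
      have : (a u : ℂ) ≠ 0 := by exact_mod_cast hau.ne'
      simp only [hω]
      generalize a u = A at *
      generalize Real.tan u = T at *
      push_cast
      field_simp
      linear_combination (-(s * A * T : ℂ)) * I_sq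
    rw [v1, v2, Complex.exp_neg]
    have hE := Complex.exp_ne_zero ((π / 2 * s : ℝ) : ℂ)
    generalize Complex.exp ((π / 2 * s : ℝ) : ℂ) = E at *
    generalize Complex.exp (I * (h u : ℂ)) = X
    generalize ((β / a u + Real.tan u : ℝ) : ℂ) = v
    field_simp
    linear_combination (2 : ℂ) * X * I_sq
  have hbd : ∀ u, ‖Complex.exp (I * (h u : ℂ))‖ = 1 := by
    intro u
    rw [mul_comm, Complex.norm_exp_ofReal_mul_I]
  have hmeas : Measurable (fun u => Complex.exp (I * (h u : ℂ))) := by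
    have := cms_measurable_tan
    have h1 : Measurable h := by
      simp only [hh, ha]
      fun_prop
    fun_prop
  have hIntg : IntegrableOn (fun u => Complex.exp (I * (h u : ℂ))) (Set.Ioo (-(π / 2)) (π / 2)) := by
    refine Integrable.mono' (g := fun _ => (1 : ℝ)) ?_ hmeas.aestronglyMeasurable ?_
    · exact integrable_const _
    · exact Filter.Eventually.of_forall fun u => (hbd u).le
  set l := nhdsWithin (π / 2) (Set.Iio (π / 2)) with hl
  have hlI : ∀ᶠ u in l, u ∈ Set.Ioo 0 (π / 2) := Ioo_mem_nhdsLT (by positivity)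
  have T1 : Filter.Tendsto (fun u => ∫ x in (-u)..u, Complex.exp (I * (h x : ℂ))) l
      (nhds (∫ x in Set.Ioo (-(π / 2)) (π / 2), Complex.exp (I * (h x : ℂ)))) := by
    have hid : Filter.Tendsto (fun u : ℝ => u) l (nhds (π / 2)) := Filter.tendsto_id.mono_left nhdsWithin_le_nhds
    have cov := aecover_Ioc_of_Ioo (μ := volume) (hid.neg) hid
    rw [Measure.restrict_congr_set Ioo_ae_eq_Ioc.symm] at cov
    have := cov.integral_tendsto_of_countably_generated hIntg
    refine this.congr' ?_
    filter_upwards [hlI] with u hu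
    rw [intervalIntegral.integral_of_le (by linarith [hu.1]), integral_Ioc_eq_integral_Ioo,
      Measure.restrict_restrict measurableSet_Ioo, Set.inter_eq_left.2]
    intro x hx
    exact ⟨by linarith [hx.1, hu.2], by linarith [hx.2, hu.2]⟩
  have T2 : ∀ᶠ u in l, ∫ x in (-u)..u, Complex.exp (I * (h x : ℂ)) = (G u - G (-u)) / 2 := by
    filter_upwards [hlI] with u hu
    have hsub : Set.uIcc (-u) u ⊆ Set.Ioo (-(π / 2)) (π / 2) := by
      rw [Set.uIcc_of_le (by linarith [hu.1])]
      intro x hx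
      exact ⟨by linarith [hx.1, hu.2], by linarith [hx.2, hu.2]⟩
    have := intervalIntegral.integral_eq_sub_of_hasDerivAt (a := -u) (b := u)
      (fun x hx => hder x (hsub hx)) ?_
    · rw [← this, intervalIntegral.integral_const_mul]
      ring
    · refine IntervalIntegrable.const_mul ?_ 2
      rw [intervalIntegrable_iff]
      exact hIntg.mono_set (Set.uIoc_subset_uIcc.trans hsub)
  have htan : Filter.Tendsto Real.tan l Filter.atTop := Real.tendsto_tan_pi_div_two
  have hsym : ∀ u ∈ Set.Ioo 0 (π / 2), u ∈ Set.Ioo (-(π / 2)) (π / 2) ∧ -u ∈ Set.Ioo (-(π / 2)) (π / 2) := by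
    intro u hu
    refine ⟨⟨?_, ?_⟩, ⟨?_, ?_⟩⟩ <;> linarith [hu.1, hu.2]
  have hlarge : Filter.Tendsto (fun u => s * m * Real.tan u) l Filter.atTop :=
    htan.const_mul_atTop (by positivity)
  have B1 : Filter.Tendsto (fun u => s * a u * Real.tan u) l Filter.atTop := by
    refine Filter.tendsto_atTop_mono' l ?_ hlarge
    filter_upwards [hlI] with u hu
    have := ha1 u (hsym u hu).1
    have ht : 0 < Real.tan u := Real.tan_pos_of_pos_of_lt_pi_div_two hu.1 hu.2
    gcongr
  have B2 : Filter.Tendsto (fun u => s * a (-u) * Real.tan u) l Filter.atTop := by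
    refine Filter.tendsto_atTop_mono' l ?_ hlarge
    filter_upwards [hlI] with u hu
    have := ha1 (-u) (hsym u hu).2
    have ht : 0 < Real.tan u := Real.tan_pos_of_pos_of_lt_pi_div_two hu.1 hu.2
    gcongr
  have R1 : ∀ᶠ u in l, 0 < s * a u ∧ s * a u ≤ s * π := by
    filter_upwards [hlI] with u hu
    have h1 := ha1 u (hsym u hu).1
    have h2 := ha2 u (hsym u hu).1
    exact ⟨by have := hm0.trans_le h1; positivity, by gcongr⟩
  have R2 : ∀ᶠ u in l, 0 < s * a (-u) ∧ s * a (-u) ≤ s * π := by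
    filter_upwards [hlI] with u hu
    have h1 := ha1 (-u) (hsym u hu).2
    have h2 := ha2 (-u) (hsym u hu).2
    exact ⟨by have := hm0.trans_le h1; positivity, by gcongr⟩
  have L1 := hL1 l ζ (fun u => ζ (-u)) (s * π) (by simpa only [hζre] using R1)
    (by simpa only [hζre] using R2) (by simpa only [hζim] using B1) (by
      simp only [hζim, Real.tan_neg, mul_neg]
      exact Filter.tendsto_neg_atTop_atBot.comp B2)
  have L2 := hL2 l (fun u => ω (-u)) ω (s * π) (by simpa only [hωre] using R2)
    (by simpa only [hωre] using R1) (by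
      simpa only [hωim, Real.tan_neg, mul_neg, neg_neg] using B2) (by
      simp only [hωim]
      exact Filter.tendsto_neg_atTop_atBot.comp B1)
  have d1 : cmsDens (2 - b * I) 1 = Complex.exp (-1) := by
    simp [cmsDens]
  have d2 : cmsDens (2 - b * I) (-1) = 0 := by
    rw [cmsDens, Set.indicator_of_notMem]
    simp
  rw [d1] at L1
  rw [d2] at L2
  have T3 := ((L1.const_mul (-I * Complex.exp (-(π / 2 * s : ℝ)))).sub
    (L2.const_mul (I * Complex.exp ((π / 2 * s : ℝ))))).div_const 2
  have T4 := T1.congr' T2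
  have hfin := tendsto_nhds_unique T4 (T3.congr fun u => by simp only [hG]; ring)
  have hΓ : Complex.Gamma (2 - b * I) = (1 - b * I) * Complex.Gamma (1 - b * I) := by
    rw [← Complex.Gamma_add_one]
    · congr 1; ring
    · intro h
      have := congrArg Complex.re h
      simp at this
  have hne : (1 - b * I : ℂ) ≠ 0 := by
    intro h
    have := congrArg Complex.re h
    simp at this
  have hΓ0 : Complex.Gamma (1 - b * I) ≠ 0 := Complex.Gamma_ne_zero_of_re_pos (by simp)
  refine hfin.trans ?_
  rw [hΓ]
  have hE1 : Complex.exp ((1 : ℝ) : ℂ) * Complex.exp (-1) = 1 := by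
    rw [← Complex.exp_add]; simp
  generalize Complex.exp ((1 : ℝ) : ℂ) = E1 at *
  generalize Complex.exp (-1) = E2 at *
  push_cast
  generalize Complex.Gamma (1 - b * I) = Γ at *
  have : ∀ X : ℂ, X * E1 * E2 = X := fun X => by rw [mul_assoc, hE1, mul_one]
  rw [show (2 * (π : ℂ) * E1 * E2) = 2 * π from this _]
  generalize (1 - b * I : ℂ) = c at hne ⊢
  field_simp
  simp


/-- The CMS map. -/
noncomputable def cmsMap (β : ℝ) (p : ℝ × ℝ) : ℝ :=
  (2 / π) * ((π / 2 + β * p.2) * Real.tan p.2 -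
    β * Real.log ((π / 2) * p.1 * Real.cos p.2 / (π / 2 + β * p.2)))

lemma cms_measurable_map (β : ℝ) : Measurable (cmsMap β) := by
  have h : Measurable (fun p : ℝ × ℝ => Real.tan p.2) := cms_measurable_tan.comp measurable_snd
  unfold cmsMap
  fun_prop

lemma cms_expOne_prob : IsProbabilityMeasure expOne := by
  constructor
  rw [expOne, withDensity_apply _ MeasurableSet.univ, Measure.restrict_univ,
    ← ofReal_integral_eq_lintegral_ofReal]
  · rw [integral_exp_neg_Ioi_zero, ENNReal.ofReal_one]
  · exact integrableOn_exp_neg_Ioi 0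
  · exact Filter.Eventually.of_forall fun x => (Real.exp_pos _).le

lemma cms_unif_prob : IsProbabilityMeasure unifHalfPi := by
  constructor
  have := Real.pi_pos
  simp only [unifHalfPi, Measure.smul_apply, Measure.restrict_apply MeasurableSet.univ,
    Set.univ_inter, Real.volume_Ioo, smul_eq_mul]
  rw [← ENNReal.ofReal_mul (by positivity)]
  rw [show π⁻¹ * (π / 2 - -(π / 2)) = 1 by field_simp; ring, ENNReal.ofReal_one]

lemma cms_ae : ∀ᵐ p ∂(expOne.prod unifHalfPi), 0 < p.1 ∧ p.2 ∈ Set.Ioo (-(π / 2)) (π / 2) := by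
  have := cms_expOne_prob
  have := cms_unif_prob
  have h1 : ∀ᵐ w ∂expOne, 0 < w :=
    (withDensity_absolutelyContinuous _ _).ae_le (ae_restrict_mem measurableSet_Ioi)
  have h2 : ∀ᵐ u ∂unifHalfPi, u ∈ Set.Ioo (-(π / 2)) (π / 2) :=
    (Measure.smul_absolutelyContinuous).ae_le (ae_restrict_mem measurableSet_Ioo)
  filter_upwards [Measure.quasiMeasurePreserving_fst.ae h1,
    Measure.quasiMeasurePreserving_snd.ae h2] with p hp1 hp2
  exact ⟨hp1, hp2⟩

lemma cms_charFunc (β t : ℝ) : charFunc (Measure.map (cmsMap β) (expOne.prod unifHalfPi)) t =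
    ∫ p, Complex.exp (I * t * cmsMap β p) ∂(expOne.prod unifHalfPi) := by
  rw [charFunc, integral_map (cms_measurable_map β).aemeasurable]
  exact Continuous.aestronglyMeasurable (by fun_prop)

lemma cms_gamma_expOne (b : ℝ) : ∫ w, Complex.exp (-(b * I) * Real.log w) ∂expOne =
    Complex.Gamma (1 - b * I) := by
  rw [expOne, integral_withDensity_eq_integral_toReal_smul (by fun_prop)
    (Filter.Eventually.of_forall fun _ => ENNReal.ofReal_lt_top),
    Complex.Gamma_eq_integral (by simp), Complex.GammaIntegral]
  refine setIntegral_congr_fun measurableSet_Ioi fun w hw => ?_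
  have hw : 0 < w := hw
  have hw0 : (w : ℂ) ≠ 0 := by exact_mod_cast hw.ne'
  rw [ENNReal.toReal_ofReal (Real.exp_pos _).le, Complex.real_smul,
    Complex.cpow_def_of_ne_zero hw0, Complex.ofReal_log hw.le]
  congr 2
  ring

lemma cms_open_pos (β t : ℝ) (hβ : |β| < 1) (ht : 0 < t) :
    ∫ p, Complex.exp (I * t * cmsMap β p) ∂(expOne.prod unifHalfPi) =
      Complex.exp (-t * (1 + I * β * (2 / π : ℝ) * Real.log t)) := by
  have i1 := cms_expOne_prob
  have i2 := cms_unif_prob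
  have hpi := Real.pi_pos
  set s : ℝ := 2 / π * t with hs
  have hs0 : 0 < s := by positivity
  have hts : t = π / 2 * s := by rw [hs]; field_simp
  set b : ℝ := β * s with hb
  set h : ℝ → ℝ := fun u => s * ((π / 2 + β * u) * Real.tan u) +
      β * s * Real.log (s * (π / 2 + β * u) / Real.cos u) with hh
  have key : ∀ᵐ p ∂(expOne.prod unifHalfPi), Complex.exp (I * t * cmsMap β p) =
      Complex.exp (-(b * I) * Real.log p.1) *
        (Complex.exp (-(b * I) * Real.log t) * Complex.exp (I * (h p.2 : ℂ))) := by
    filter_upwards [cms_ae] with p hp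
    obtain ⟨hw, hu⟩ := hp
    have hc : 0 < Real.cos p.2 := Real.cos_pos_of_mem_Ioo hu
    have ha : 0 < π / 2 + β * p.2 := by
      have h1 : |p.2| < π / 2 := abs_lt.2 hu
      have h2 : |β * p.2| ≤ 1 * |p.2| := by rw [abs_mul]; gcongr
      have := neg_le_of_abs_le h2
      linarith
    have hmain : t * cmsMap β p = h p.2 - b * Real.log p.1 - b * Real.log t := by
      have e1 : Real.log ((π / 2) * p.1 * Real.cos p.2 / (π / 2 + β * p.2)) =
          Real.log (π / 2) + Real.log p.1 + Real.log (Real.cos p.2) -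
            Real.log (π / 2 + β * p.2) := by
        rw [Real.log_div (by positivity) ha.ne', Real.log_mul (by positivity) hc.ne',
          Real.log_mul (by positivity) hw.ne']
      have e2 : Real.log (s * (π / 2 + β * p.2) / Real.cos p.2) =
          Real.log s + Real.log (π / 2 + β * p.2) - Real.log (Real.cos p.2) := by
        rw [Real.log_div (by positivity) hc.ne', Real.log_mul hs0.ne' ha.ne']
      have e3 : Real.log t = Real.log (π / 2) + Real.log s := by
        rw [hts, Real.log_mul (by positivity) hs0.ne']
      simp only [hh, cmsMap]
      rw [e1, e2, e3, hb]
      have : t * (2 / π) = s := by rw [hs]; ring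
      rw [← mul_assoc, this]
      ring
    rw [← Complex.exp_add, ← Complex.exp_add]
    congr 1
    rw [mul_assoc, ← Complex.ofReal_mul, hmain]
    push_cast
    ring
  rw [integral_congr_ae key, integral_prod_mul (fun w : ℝ => Complex.exp (-(b * I) * Real.log w))
    (fun u : ℝ => Complex.exp (-(b * I) * Real.log t) * Complex.exp (I * (h u : ℂ))),
    cms_gamma_expOne, integral_const_mul, unifHalfPi, integral_smul_measure,
    cms_core β s hβ hs0, ENNReal.toReal_ofReal (by positivity), Complex.real_smul]
  have hΓ0 : Complex.Gamma (1 - b * I) ≠ 0 := Complex.Gamma_ne_zero_of_re_pos (by simp)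
  have hpc : (π : ℂ) ≠ 0 := by exact_mod_cast hpi.ne'
  have e : Complex.exp (-t * (1 + I * β * (2 / π : ℝ) * Real.log t)) =
      Complex.exp (-(b * I) * Real.log t) * Complex.exp (-(π / 2 * s : ℝ)) := by
    rw [← Complex.exp_add, ← hts]
    congr 1
    rw [hb, hs]
    push_cast
    ring
  rw [e, ← hb]
  generalize Complex.Gamma (1 - b * I) = Γ at *
  push_cast
  field_simp

lemma cms_closed_pos (β t : ℝ) (hβ : |β| ≤ 1) (ht : 0 < t) :
    ∫ p, Complex.exp (I * t * cmsMap β p) ∂(expOne.prod unifHalfPi) =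
      Complex.exp (-t * (1 + I * β * (2 / π : ℝ) * Real.log t)) := by
  have i1 := cms_expOne_prob
  have i2 := cms_unif_prob
  have hpi := Real.pi_pos
  set B : ℕ → ℝ := fun n => (1 - 1 / ((n : ℝ) + 1)) * β with hB
  have hBt : Filter.Tendsto B Filter.atTop (nhds β) := by
    have := ((tendsto_one_div_add_atTop_nhds_zero_nat (𝕜 := ℝ)).const_sub 1).mul_const β
    rw [sub_zero, one_mul] at this
    exact this
  have hB1 : ∀ n, |B n| < 1 := by
    intro n
    have h1 : (0 : ℝ) < 1 / ((n : ℝ) + 1) := by positivity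
    have h2 : 1 / ((n : ℝ) + 1) ≤ 1 := by
      rw [div_le_one (by positivity)]
      have : (0 : ℝ) ≤ n := Nat.cast_nonneg n
      linarith
    simp only [hB]
    rw [abs_mul, abs_of_nonneg (by linarith)]
    have := abs_nonneg β
    nlinarith
  have T1 : Filter.Tendsto (fun n => ∫ p, Complex.exp (I * t * cmsMap (B n) p)
      ∂(expOne.prod unifHalfPi)) Filter.atTop
      (nhds (∫ p, Complex.exp (I * t * cmsMap β p) ∂(expOne.prod unifHalfPi))) := by
    refine tendsto_integral_of_dominated_convergence (fun _ => (1 : ℝ)) ?_ (integrable_const _)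
      ?_ ?_
    · intro n
      have := cms_measurable_map (B n)
      exact Measurable.aestronglyMeasurable (by fun_prop)
    · intro n
      refine Filter.Eventually.of_forall fun p => ?_
      rw [Complex.norm_exp]
      simp
    · filter_upwards [cms_ae] with p hp
      obtain ⟨hw, hu⟩ := hp
      have hc : 0 < Real.cos p.2 := Real.cos_pos_of_mem_Ioo hu
      have ha : 0 < π / 2 + β * p.2 := by
        have h1 : |p.2| < π / 2 := abs_lt.2 hu
        have h2 : |β * p.2| ≤ 1 * |p.2| := by rw [abs_mul]; gcongr
        have := neg_le_of_abs_le h2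
        linarith
      have hcont : ContinuousAt (fun β => Complex.exp (I * t * cmsMap β p)) β := by
        have h1 : ContinuousAt (fun β => (π / 2) * p.1 * Real.cos p.2 / (π / 2 + β * p.2)) β :=
          ContinuousAt.div (by fun_prop) (by fun_prop) ha.ne'
        have h2 := h1.log (by positivity)
        have h3 : ContinuousAt (fun β => cmsMap β p) β := by
          unfold cmsMap
          fun_prop
        have h4 := Complex.continuous_ofReal.continuousAt.comp h3
        exact (continuousAt_const.mul h4).cexp
      exact hcont.tendsto.comp hBt
  have T2 : Filter.Tendsto (fun n => Complex.exp (-t * (1 + I * B n * (2 / π : ℝ) * Real.log t)))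
      Filter.atTop (nhds (Complex.exp (-t * (1 + I * β * (2 / π : ℝ) * Real.log t)))) := by
    have hcont : Continuous (fun β : ℝ =>
        Complex.exp (-t * (1 + I * β * (2 / π : ℝ) * Real.log t))) := by fun_prop
    exact (hcont.tendsto β).comp hBt
  refine tendsto_nhds_unique T1 (T2.congr fun n => ?_)
  rw [cms_open_pos (B n) t (hB1 n) ht]


/-- Chambers–Mallows–Stuck, case `α = 1`: the pushforward of `Exp(1) ⊗ U(-π/2,π/2)` under the
CMS map has the characteristic function `exp(-|t| (1 + i β (2/π) sgn(t) log|t|))`.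
(At `t = 0` the right-hand side equals `1` since `Real.sign 0 = 0` and `Real.log 0 = 0`.) -/
theorem cms_alpha_eq_one (β : ℝ) (hβ : β ∈ Set.Icc (-1 : ℝ) 1) :
    ∀ t : ℝ,
      charFunc
        (Measure.map
          (fun p : ℝ × ℝ =>
            (2 / π) * ((π / 2 + β * p.2) * Real.tan p.2 -
              β * Real.log ((π / 2) * p.1 * Real.cos p.2 / (π / 2 + β * p.2))))
          (expOne.prod unifHalfPi)) t =
      Complex.exp (-(|t| : ℝ) *
        (1 + Complex.I * (β : ℂ) * ((2 / π : ℝ) : ℂ) * (Real.sign t : ℂ) *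
          (Real.log |t| : ℂ))) := by
  intro t
  have i1 := cms_expOne_prob
  have i2 := cms_unif_prob
  have hb : |β| ≤ 1 := abs_le.2 hβ
  change charFunc (Measure.map (cmsMap β) (expOne.prod unifHalfPi)) t = _
  rw [cms_charFunc]
  rcases lt_trichotomy t 0 with ht | rfl | ht
  · have h1 := congrArg (starRingEnd ℂ) (cms_closed_pos β (-t) hb (by linarith))
    rw [← integral_conj] at h1
    rw [Real.sign_of_neg ht, abs_of_neg ht]
    convert! h1 using 1
    · congr 1
      ext p
      rw [← Complex.exp_conj]
      congr 1
      simp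
    · rw [← Complex.exp_conj]
      congr 1
      simp only [map_mul, map_add, map_neg, map_one, Complex.conj_ofReal, Complex.conj_I]
      push_cast
      ring
  · simp
  · rw [Real.sign_of_pos ht, abs_of_pos ht, cms_closed_pos β t hb ht]
    simp
end

section
/- Let c > 0 and μ ∈ ℝ. The probability measure on ℝ with Lebesgue density x ↦ √(c/(2π)) · (x−μ)^{−3/2} · exp(−c/(2(x−μ))) for x > μ (and 0 for x ≤ μ) — the Lévy distribution L(μ,c) — has characteristic function t ↦ exp(i t μ − √(c|t|)·(1 − i·sgn t)), which equals the α-stable characteristic function exp(i t μ − |c t|^{1/2}[1 − i β tan(πα/2) sgn t]) at α = 1/2, β = 1. -/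
open MeasureTheory Real Complex

/-- The Lévy distribution `L(μ, c)` with density
`x ↦ √(c/(2π)) (x-μ)^{-3/2} exp(-c/(2(x-μ)))` for `x > μ` and `0` otherwise. -/
noncomputable def levyMeasure (μ c : ℝ) : Measure ℝ :=
  volume.withDensity fun x =>
    ENNReal.ofReal
      (if μ < x then
        Real.sqrt (c / (2 * π)) * (x - μ) ^ (-(3 / 2) : ℝ) * Real.exp (-c / (2 * (x - μ)))
      else 0)

lemma aux_ftc {g g' : ℝ → ℝ} {l₀ l : ℝ} (hd : ∀ x ∈ Set.Ioi (0:ℝ), HasDerivAt g (g' x) x)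
    (hneg : ∀ x ∈ Set.Ioi (0:ℝ), g' x ≤ 0)
    (h0 : Filter.Tendsto g (nhdsWithin 0 (Set.Ioi 0)) (nhds l₀))
    (h1 : Filter.Tendsto g Filter.atTop (nhds l)) :
    IntegrableOn g' (Set.Ioi 0) ∧ ∫ x in Set.Ioi (0:ℝ), g' x = l - l₀ := by
  have hd' : ∀ x ∈ Set.Ioi (0:ℝ), HasDerivAt (Function.update g 0 l₀) (g' x) x := by
    intro x hx
    refine (hd x hx).congr_of_eventuallyEq ?_
    filter_upwards [isOpen_Ioi.mem_nhds hx] with y hy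
    exact Function.update_of_ne (ne_of_gt hy) _ _
  have hc : ContinuousWithinAt (Function.update g 0 l₀) (Set.Ici 0) 0 := by
    rw [continuousWithinAt_update_same]
    rwa [Set.Ici_sdiff_left]
  have h1' : Filter.Tendsto (Function.update g 0 l₀) Filter.atTop (nhds l) := by
    refine h1.congr' ?_
    filter_upwards [Filter.eventually_gt_atTop 0] with y hy
    exact (Function.update_of_ne (ne_of_gt hy) _ _).symm
  refine ⟨integrableOn_Ioi_deriv_of_nonpos hc hd' hneg h1', ?_⟩
  have := integral_Ioi_of_hasDerivAt_of_nonpos hc hd' hneg h1'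
  simpa using this

noncomputable def auxE (y : ℝ) : ℝ := ∫ s in (0:ℝ)..y, Real.exp (-1 * s ^ 2)

lemma auxE_deriv (y : ℝ) : HasDerivAt auxE (Real.exp (-1 * y ^ 2)) y := by
  have hc : Continuous fun s : ℝ => Real.exp (-1 * s ^ 2) := by fun_prop
  exact (hc.integral_hasStrictDerivAt 0 y).hasDerivAt

lemma auxE_top : Filter.Tendsto auxE Filter.atTop (nhds (Real.sqrt π / 2)) := by
  have := intervalIntegral_tendsto_integral_Ioi (μ := volume) (0:ℝ)
    (integrable_exp_neg_mul_sq (b := 1) one_pos).integrableOn Filter.tendsto_id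
  rw [integral_gaussian_Ioi] at this
  have h : auxE = fun y => ∫ s in (0:ℝ)..y, Real.exp (-1 * s ^ 2) := rfl
  rw [h]
  simpa using this

lemma auxE_neg (y : ℝ) : auxE (-y) = - auxE y := by
  have := intervalIntegral.integral_comp_neg (a := 0) (b := y) (fun s : ℝ => Real.exp (-1 * s ^ 2))
  simp only [neg_sq, neg_zero] at this
  rw [auxE, auxE, this, intervalIntegral.integral_symm]

lemma auxE_bot : Filter.Tendsto auxE Filter.atBot (nhds (-(Real.sqrt π / 2))) := by
  have h := (auxE_top.comp Filter.tendsto_neg_atBot_atTop).neg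
  refine h.congr fun y => ?_
  simp [auxE_neg]

noncomputable def auxH (a b x : ℝ) : ℝ :=
  Real.exp (2 * a * b) * auxE (a / Real.sqrt x + b * Real.sqrt x) +
    Real.exp (-(2 * a * b)) * auxE (a / Real.sqrt x - b * Real.sqrt x)

lemma auxH_deriv (a b x : ℝ) (hx : 0 < x) :
    HasDerivAt (auxH a b) (-(a * x ^ (-(3 / 2) : ℝ) * Real.exp (-a ^ 2 / x - b ^ 2 * x))) x := by
  have hr : 0 < Real.sqrt x := Real.sqrt_pos.2 hx
  have hs := Real.hasDerivAt_sqrt hx.ne'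
  have h1 : HasDerivAt (fun x => a / Real.sqrt x + b * Real.sqrt x) _ x :=
    ((hasDerivAt_const x a).div hs hr.ne').add (hs.const_mul b)
  have h2 : HasDerivAt (fun x => a / Real.sqrt x - b * Real.sqrt x) _ x :=
    ((hasDerivAt_const x a).div hs hr.ne').sub (hs.const_mul b)
  have h3 := (((auxE_deriv _).comp x h1).const_mul (Real.exp (2 * a * b))).add
    (((auxE_deriv _).comp x h2).const_mul (Real.exp (-(2 * a * b))))
  refine HasDerivAt.congr_deriv (f := auxH a b) h3 ?_
  have hpow : x ^ (-(3 / 2) : ℝ) = (Real.sqrt x ^ 3)⁻¹ := by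
    rw [Real.rpow_neg hx.le, Real.sqrt_eq_rpow, ← Real.rpow_natCast, ← Real.rpow_mul hx.le]
    norm_num
  have hx2 : Real.sqrt x ^ 2 = x := Real.sq_sqrt hx.le
  have e1 : Real.exp (2 * a * b) * Real.exp (-1 * (a / Real.sqrt x + b * Real.sqrt x) ^ 2)
      = Real.exp (-a ^ 2 / x - b ^ 2 * x) := by
    rw [← Real.exp_add]; congr 1
    rw [← hx2]; simp only [Real.sqrt_sq hr.le]; field_simp; ring
  have e2 : Real.exp (-(2 * a * b)) * Real.exp (-1 * (a / Real.sqrt x - b * Real.sqrt x) ^ 2)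
      = Real.exp (-a ^ 2 / x - b ^ 2 * x) := by
    rw [← Real.exp_add]; congr 1
    rw [← hx2]; simp only [Real.sqrt_sq hr.le]; field_simp; ring
  rw [← mul_assoc, ← mul_assoc, e1, e2, hpow]
  field_simp
  ring

lemma aux_sqrt_zero : Filter.Tendsto Real.sqrt (nhdsWithin 0 (Set.Ioi 0))
    (nhdsWithin 0 (Set.Ioi 0)) := by
  refine tendsto_nhdsWithin_iff.2 ⟨?_, ?_⟩
  · have := (Real.continuous_sqrt.tendsto 0).mono_left
      (nhdsWithin_le_nhds (s := Set.Ioi (0:ℝ)))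
    simpa using this
  · filter_upwards [self_mem_nhdsWithin] with x hx
    exact Real.sqrt_pos.2 hx

lemma auxH_zero (a b : ℝ) (ha : 0 < a) :
    Filter.Tendsto (auxH a b) (nhdsWithin 0 (Set.Ioi 0))
      (nhds (Real.exp (2 * a * b) * (Real.sqrt π / 2) +
        Real.exp (-(2 * a * b)) * (Real.sqrt π / 2))) := by
  have h1 : Filter.Tendsto (fun x => a / Real.sqrt x) (nhdsWithin 0 (Set.Ioi 0)) Filter.atTop := by
    simp only [div_eq_mul_inv]
    exact (tendsto_inv_nhdsGT_zero.comp aux_sqrt_zero).const_mul_atTop ha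
  have h2 : Filter.Tendsto (fun x => b * Real.sqrt x) (nhdsWithin 0 (Set.Ioi 0)) (nhds (b * 0)) :=
    (aux_sqrt_zero.mono_right nhdsWithin_le_nhds).const_mul b
  refine ((auxE_top.comp (h1.atTop_add h2)).const_mul _).add
    ((auxE_top.comp (Filter.Tendsto.atTop_add h1 h2.neg)).const_mul _) |>.congr fun x => ?_
  simp [auxH, sub_eq_add_neg]

lemma aux_div_top (a : ℝ) : Filter.Tendsto (fun x => a / Real.sqrt x) Filter.atTop (nhds 0) :=
  Filter.Tendsto.div_atTop tendsto_const_nhds Real.tendsto_sqrt_atTop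

lemma auxH_top (a b : ℝ) (hb : 0 < b) :
    Filter.Tendsto (auxH a b) Filter.atTop
      (nhds (Real.exp (2 * a * b) * (Real.sqrt π / 2) +
        Real.exp (-(2 * a * b)) * (-(Real.sqrt π / 2)))) := by
  have h2 : Filter.Tendsto (fun x => b * Real.sqrt x) Filter.atTop Filter.atTop :=
    Real.tendsto_sqrt_atTop.const_mul_atTop hb
  refine ((auxE_top.comp ((aux_div_top a).add_atTop h2)).const_mul _).add
    ((auxE_bot.comp ((aux_div_top a).add_atBot
      (Filter.tendsto_neg_atTop_atBot.comp h2))).const_mul _) |>.congr fun x => ?_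
  simp [auxH, sub_eq_add_neg]

lemma auxH_top' (a : ℝ) : Filter.Tendsto (auxH a 0) Filter.atTop (nhds (auxE 0 + auxE 0)) := by
  have h : Filter.Tendsto auxE (nhds 0) (nhds (auxE 0)) := (auxE_deriv 0).continuousAt
  refine ((h.comp (aux_div_top a)).add (h.comp (aux_div_top a))).congr fun x => ?_
  simp [auxH]

/-- Lévy density at location zero. -/
noncomputable def levyP (c x : ℝ) : ℝ :=
  Real.sqrt (c / (2 * π)) * x ^ (-(3 / 2) : ℝ) * Real.exp (-c / (2 * x))

lemma levyP_mul (c s x : ℝ) (hc : 0 < c) (hs : 0 ≤ s) (hx : 0 < x) :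
    levyP c x * Real.exp (-s * x) = (-(Real.sqrt π)⁻¹) *
      (-(Real.sqrt (c / 2) * x ^ (-(3 / 2) : ℝ) *
        Real.exp (-Real.sqrt (c / 2) ^ 2 / x - Real.sqrt s ^ 2 * x))) := by
  rw [Real.sq_sqrt (by positivity), Real.sq_sqrt hs, levyP, mul_assoc, ← Real.exp_add,
    ← div_div, Real.sqrt_div (by positivity)]
  have : -c / (2 * x) + -s * x = -(c / 2) / x - s * x := by field_simp; ring
  rw [this]
  field_simp

lemma levyP_integrable (c s : ℝ) (hc : 0 < c) (hs : 0 ≤ s) :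
    IntegrableOn (fun x => levyP c x * Real.exp (-s * x)) (Set.Ioi 0) := by
  have ha : 0 < Real.sqrt (c / 2) := Real.sqrt_pos.2 (by positivity)
  have key : ∃ l, Filter.Tendsto (auxH (Real.sqrt (c / 2)) (Real.sqrt s)) Filter.atTop (nhds l) := by
    rcases hs.eq_or_lt with rfl | h
    · exact ⟨_, by simpa using auxH_top' _⟩
    · exact ⟨_, auxH_top _ _ (Real.sqrt_pos.2 h)⟩
  obtain ⟨l, hl⟩ := key
  have := (aux_ftc (fun x hx => auxH_deriv _ _ x hx) (fun x hx => by
    have : (0:ℝ) < x := hx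
    rw [neg_nonpos]; positivity) (auxH_zero _ _ ha) hl).1
  refine IntegrableOn.congr_fun (this.const_mul (-(Real.sqrt π)⁻¹)) ?_ measurableSet_Ioi
  intro x hx
  exact (levyP_mul c s x hc hs hx).symm

lemma levyP_integral (c s : ℝ) (hc : 0 < c) (hs : 0 < s) :
    ∫ x in Set.Ioi 0, levyP c x * Real.exp (-s * x) = Real.exp (-Real.sqrt (2 * c * s)) := by
  have ha : 0 < Real.sqrt (c / 2) := Real.sqrt_pos.2 (by positivity)
  have := (aux_ftc (fun x hx => auxH_deriv _ _ x hx) (fun x hx => by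
    have : (0:ℝ) < x := hx
    rw [neg_nonpos]; positivity) (auxH_zero _ _ ha) (auxH_top _ _ (Real.sqrt_pos.2 hs))).2
  rw [setIntegral_congr_fun measurableSet_Ioi (fun x hx => levyP_mul c s x hc hs.le hx),
    integral_const_mul, this]
  have e : Real.sqrt (2 * c * s) = 2 * Real.sqrt (c / 2) * Real.sqrt s := by
    rw [show 2 * c * s = 2 ^ 2 * (c / 2) * s by ring, Real.sqrt_mul (by positivity),
      Real.sqrt_mul (by positivity), Real.sqrt_sq (by norm_num)]
  rw [e]
  have : Real.sqrt π ≠ 0 := (Real.sqrt_pos.2 Real.pi_pos).ne'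
  field_simp
  ring

lemma levyP_nonneg (c x : ℝ) (hx : 0 < x) : 0 ≤ levyP c x := by
  unfold levyP; positivity

lemma levyP_measurable (c : ℝ) : Measurable (levyP c) := by
  unfold levyP; fun_prop

noncomputable def levyD (μ c x : ℝ) : ℝ := if μ < x then levyP c (x - μ) else 0

lemma levyD_measurable (μ c : ℝ) : Measurable (levyD μ c) :=
  Measurable.ite measurableSet_Ioi ((levyP_measurable c).comp (measurable_id.sub_const μ))
    measurable_const

lemma levyD_nonneg (μ c x : ℝ) : 0 ≤ levyD μ c x := by
  unfold levyD
  split_ifs with h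
  · exact levyP_nonneg _ _ (sub_pos.2 h)
  · exact le_rfl

lemma levyMeasure_eq (μ c : ℝ) :
    levyMeasure μ c = volume.withDensity fun x => ENNReal.ofReal (levyD μ c x) := rfl

lemma levy_integral {E : Type*} [NormedAddCommGroup E] [NormedSpace ℝ E] (μ c : ℝ) (f : ℝ → E) :
    ∫ x, f x ∂(levyMeasure μ c) = ∫ x in Set.Ioi 0, levyP c x • f (x + μ) := by
  rw [levyMeasure_eq, integral_withDensity_eq_integral_toReal_smul₀
    (levyD_measurable μ c).ennreal_ofReal.aemeasurable (by simp),
    ← integral_add_right_eq_self _ μ, ← integral_indicator measurableSet_Ioi]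
  congr 1
  ext x
  rw [ENNReal.toReal_ofReal (levyD_nonneg _ _ _)]
  by_cases hx : 0 < x <;> simp [levyD, Set.indicator, hx]

lemma levy_integrable {E : Type*} [NormedAddCommGroup E] [NormedSpace ℝ E] (c : ℝ) (f : ℝ → E) :
    Integrable f (levyMeasure 0 c) ↔ IntegrableOn (fun x => levyP c x • f x) (Set.Ioi 0) := by
  rw [levyMeasure_eq, integrable_withDensity_iff_integrable_smul'
    (levyD_measurable 0 c).ennreal_ofReal (by simp), ← integrable_indicator_iff measurableSet_Ioi]
  refine iff_of_eq (congrArg (fun g => Integrable g volume) ?_)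
  ext x
  rw [ENNReal.toReal_ofReal (levyD_nonneg _ _ _)]
  by_cases hx : 0 < x <;> simp [levyD, Set.indicator, hx]

open ProbabilityTheory in
lemma levy_mem (c s : ℝ) (hc : 0 < c) (hs : s ≤ 0) :
    s ∈ integrableExpSet id (levyMeasure 0 c) := by
  change Integrable _ _
  rw [levy_integrable]
  simpa using levyP_integrable c (-s) hc (by linarith)

open ProbabilityTheory in
lemma levy_mgf (c s : ℝ) (hc : 0 < c) (hs : s < 0) :
    complexMGF id (levyMeasure 0 c) s = Complex.exp (-(-2 * c * s : ℂ) ^ (2⁻¹ : ℂ)) := by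
  rw [complexMGF_ofReal, mgf, levy_integral]
  have := levyP_integral c (-s) hc (by linarith)
  simp only [neg_neg] at this
  simp only [smul_eq_mul, id, add_zero, this]
  have h : (-2 * c * s : ℂ) = ((2 * c * -s : ℝ) : ℂ) := by push_cast; ring
  rw [h, Real.sqrt_eq_rpow, Complex.ofReal_exp, Complex.ofReal_neg,
    Complex.ofReal_cpow (by nlinarith)]
  norm_num

open ProbabilityTheory in
lemma levy_complexMGF (c : ℝ) (hc : 0 < c) :
    Set.EqOn (complexMGF id (levyMeasure 0 c))
      (fun z => Complex.exp (-(-2 * c * z : ℂ) ^ (2⁻¹ : ℂ))) {z : ℂ | z.re < 0} := by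
  have hopen : IsOpen {z : ℂ | z.re < 0} := isOpen_lt Complex.continuous_re continuous_const
  have hsub : Set.Iio (0:ℝ) ⊆ interior (integrableExpSet id (levyMeasure 0 c)) :=
    interior_maximal (fun s hs => levy_mem c s hc (le_of_lt hs)) isOpen_Iio
  refine AnalyticOnNhd.eqOn_of_preconnected_of_frequently_eq (𝕜 := ℂ) (z₀ := ((-1 : ℝ) : ℂ))
    (analyticOnNhd_complexMGF.mono fun z hz => hsub hz) ?_ ?_ (by simp) ?_
  · refine DifferentiableOn.analyticOnNhd (fun z hz => ?_) hopen
    have hz' : z.re < 0 := hz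
    have : (-2 * c * z : ℂ) ∈ Complex.slitPlane := by
      left
      simp
      nlinarith
    refine DifferentiableAt.differentiableWithinAt ?_
    refine DifferentiableAt.cexp (DifferentiableAt.neg ?_)
    exact DifferentiableAt.cpow_const (by fun_prop) this
  · exact (convex_halfSpace_re_lt 0).isPreconnected
  · have h1 : Filter.Tendsto (fun x : ℝ => (x : ℂ)) (nhdsWithin (-1) {-1}ᶜ)
        (nhdsWithin ((-1 : ℝ) : ℂ) {((-1 : ℝ) : ℂ)}ᶜ) := by
      refine tendsto_nhdsWithin_iff.2
        ⟨(Complex.continuous_ofReal.tendsto _).mono_left nhdsWithin_le_nhds, ?_⟩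
      filter_upwards [self_mem_nhdsWithin] with x hx
      simpa using fun h => hx (Complex.ofReal_injective (by simpa using h))
    refine h1.frequently (Filter.Eventually.frequently ?_)
    have : ∀ᶠ x : ℝ in nhdsWithin (-1) {-1}ᶜ, x < 0 :=
      nhdsWithin_le_nhds (Iio_mem_nhds (by norm_num))
    filter_upwards [this] with x hx
    exact levy_mgf c x hc hx

lemma levy_charFunc_zero (c t : ℝ) (hc : 0 < c) :
    ∫ x in Set.Ioi (0:ℝ), levyP c x • Complex.exp (Complex.I * t * x) =
      Complex.exp (-(-2 * c * (Complex.I * t) : ℂ) ^ (2⁻¹ : ℂ)) := by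
  have hz : Filter.Tendsto (fun s : ℝ => (Complex.I * t - s : ℂ)) (nhdsWithin 0 (Set.Ioi 0))
      (nhds (Complex.I * t)) := by
    have : Continuous fun s : ℝ => (Complex.I * t - s : ℂ) := by fun_prop
    have := (this.tendsto 0).mono_left (nhdsWithin_le_nhds (s := Set.Ioi (0:ℝ)))
    simpa using this
  have hR : ContinuousAt (fun z : ℂ => Complex.exp (-(-2 * c * z : ℂ) ^ (2⁻¹ : ℂ)))
      (Complex.I * t) := by
    have : ContinuousAt (fun z : ℂ => (-2 * c * z : ℂ) ^ (2⁻¹ : ℂ)) (Complex.I * t) := by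
      refine ContinuousAt.comp (f := fun z : ℂ => (-2 * c * z : ℂ)) (g := fun z => z ^ (2⁻¹ : ℂ))
        (Complex.continuousAt_cpow_const_of_re_pos ?_ (by norm_num)) (by fun_prop)
      left
      simp
    exact this.neg.cexp
  refine tendsto_nhds_unique ?_ (hR.tendsto.comp hz)
  have hL : Filter.Tendsto (fun s : ℝ => ∫ x in Set.Ioi (0:ℝ),
      levyP c x • Complex.exp ((Complex.I * t - s) * x)) (nhdsWithin 0 (Set.Ioi 0))
      (nhds (∫ x in Set.Ioi (0:ℝ), levyP c x • Complex.exp (Complex.I * t * x))) := by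
    have hi := levyP_integrable c 0 hc le_rfl
    simp only [neg_zero, zero_mul, Real.exp_zero, mul_one] at hi
    refine tendsto_integral_filter_of_dominated_convergence (levyP c) ?_ ?_ hi ?_
    · refine Filter.Eventually.of_forall fun s => Measurable.aestronglyMeasurable ?_
      exact (levyP_measurable c).smul (by fun_prop)
    · filter_upwards [self_mem_nhdsWithin] with s hs
      have hs' : 0 < s := hs
      refine (ae_restrict_iff' measurableSet_Ioi).2 (Filter.Eventually.of_forall fun x hx => ?_)
      have hx' : 0 < x := hx
      rw [norm_smul, Complex.norm_exp, Real.norm_of_nonneg (levyP_nonneg c x hx)]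
      refine mul_le_of_le_one_right (levyP_nonneg c x hx) (Real.exp_le_one_iff.2 ?_)
      simp
      positivity
    · refine Filter.Eventually.of_forall fun x => ?_
      have hcx : Continuous fun z : ℂ => levyP c x • Complex.exp (z * x) := by fun_prop
      exact (hcx.tendsto _).comp hz
  refine hL.congr' ?_
  filter_upwards [self_mem_nhdsWithin] with s hs
  have hs' : 0 < s := hs
  have := levy_complexMGF c hc (x := Complex.I * t - s) (by simpa using hs')
  rw [ProbabilityTheory.complexMGF, levy_integral] at this
  simpa using this

lemma levy_root (c t : ℝ) (hc : 0 < c) :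
    (-2 * c * (Complex.I * t) : ℂ) ^ (2⁻¹ : ℂ) =
      (Real.sqrt (c * |t|) : ℂ) * (1 - Complex.I * (Real.sign t : ℂ)) := by
  rcases eq_or_ne t 0 with rfl | ht
  · simp
  have hp : 0 < c * |t| := mul_pos hc (abs_pos.2 ht)
  rw [← Complex.sq_cpow_two_inv (x := (Real.sqrt (c * |t|) : ℂ) * _)
    (by simp; positivity)]
  congr 1
  rw [mul_pow, ← Complex.ofReal_pow, Real.sq_sqrt hp.le]
  rcases lt_or_gt_of_ne ht with h | h
  · rw [Real.sign_of_neg h, abs_of_neg h]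
    push_cast
    ring_nf
    simp
  · rw [Real.sign_of_pos h, abs_of_pos h]
    push_cast
    ring_nf
    simp

/-- The Lévy distribution `L(μ, c)` has characteristic function
`t ↦ exp(i t μ - √(c|t|)(1 - i sgn t))`, which equals the `α`-stable characteristic function
`exp(i t μ - |c t|^α (1 - i β tan(πα/2) sgn t))` at `α = 1/2`, `β = 1`. -/
theorem levy_charFunc (c μ : ℝ) (hc : 0 < c) :
    (∀ t : ℝ, charFunc (levyMeasure μ c) t =
      Complex.exp (Complex.I * (t : ℂ) * (μ : ℂ) -
        (Real.sqrt (c * |t|) : ℂ) * (1 - Complex.I * (Real.sign t : ℂ)))) ∧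
    (∀ t : ℝ,
      Complex.exp (Complex.I * (t : ℂ) * (μ : ℂ) -
        (Real.sqrt (c * |t|) : ℂ) * (1 - Complex.I * (Real.sign t : ℂ))) =
      Complex.exp (Complex.I * (t : ℂ) * (μ : ℂ) - (|c * t| ^ ((1 : ℝ) / 2) : ℝ) *
        (1 - Complex.I * ((1 : ℝ) : ℂ) * (Real.tan (π * (1 / 2) / 2) : ℂ) *
          (Real.sign t : ℂ)))) := by
  constructor
  · intro t
    rw [charFunc, levy_integral]
    have h : ∀ x : ℝ, levyP c x • Complex.exp (Complex.I * t * ((x + μ : ℝ) : ℂ)) =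
        Complex.exp (Complex.I * t * μ) * (levyP c x • Complex.exp (Complex.I * t * x)) := by
      intro x
      rw [mul_smul_comm, ← Complex.exp_add]
      congr 2
      push_cast
      ring
    simp only [h]
    rw [integral_const_mul, levy_charFunc_zero c t hc, levy_root c t hc, ← Complex.exp_add,
      ← sub_eq_add_neg]
  · intro t
    have h1 : Real.tan (π * (1 / 2) / 2) = 1 := by
      rw [show π * (1 / 2) / 2 = π / 4 by ring, Real.tan_pi_div_four]
    have h2 : |c * t| ^ ((1 : ℝ) / 2) = Real.sqrt (c * |t|) := by
      rw [abs_mul, abs_of_pos hc, Real.sqrt_eq_rpow]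
    rw [h1, h2]
    simp
end
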